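/- arXiv:1503.01263 — 4 statements merged into one kernel-verified Lean document; each statement's English description precedes it below -/
import Mathlib

section
/- The series representation of the constant J₊ holds: the improper integral ∫₀^∞ (coth(u) − 1/u)/(u² + π²/4) du converges and equals (8/π²) · Σ_{k=1}^∞ ln(2k)/(4k² − 1). -/
open MeasureTheory Real

/-- `coth u = cosh u / sinh u`. -/
noncomputable def coth (u : ℝ) : ℝ := Real.cosh u / Real.sinh u

open Filter Topology in
theorem tendsto_log_sq_add_div_sq_add {a : ℝ} (b : ℝ) (ha : 0 < a) :
    Tendsto (fun u : ℝ => Real.log ((u ^ 2 + b ^ 2) / (u ^ 2 + a ^ 2))) atTop (𝓝 0) := by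
  have hsq : Tendsto (fun u : ℝ => u ^ 2 + a ^ 2) atTop atTop :=
    tendsto_atTop_add_const_right _ _ (tendsto_pow_atTop two_ne_zero)
  have hratio : Tendsto (fun u : ℝ => (u ^ 2 + b ^ 2) / (u ^ 2 + a ^ 2)) atTop (𝓝 1) := by
    have h := (tendsto_const_nhds (x := b ^ 2 - a ^ 2)).div_atTop hsq
    have h' := h.const_add 1
    rw [add_zero] at h'
    refine h'.congr fun u => ?_
    have : u ^ 2 + a ^ 2 ≠ 0 := by positivity
    field_simp
    ring
  simpa using hratio.log one_ne_zero

theorem hasDerivAt_log_sq_add_div_sq_add {a b : ℝ} (hb : 0 < b) (hab : b < a) (u : ℝ) :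
    HasDerivAt (fun u : ℝ => (a ^ 2 - b ^ 2)⁻¹ * Real.log ((u ^ 2 + b ^ 2) / (u ^ 2 + a ^ 2)))
      (2 * u / ((u ^ 2 + a ^ 2) * (u ^ 2 + b ^ 2))) u := by
  have hA : u ^ 2 + a ^ 2 ≠ 0 := by have := hb.trans hab; positivity
  have hB : u ^ 2 + b ^ 2 ≠ 0 := by positivity
  have hD : a ^ 2 - b ^ 2 ≠ 0 := by nlinarith
  have hsq (c : ℝ) : HasDerivAt (fun u : ℝ => u ^ 2 + c ^ 2) (2 * u) u := by
    simpa using (hasDerivAt_pow 2 u).add_const (c ^ 2)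
  have h := (((hsq b).fun_div (hsq a) hA).log (div_ne_zero hB hA)).const_mul (a ^ 2 - b ^ 2)⁻¹
  refine h.congr_deriv ?_
  field_simp
  ring

theorem integrableOn_Ioi_two_mul_div {a b : ℝ} (hb : 0 < b) (hab : b < a) :
    IntegrableOn (fun u : ℝ => 2 * u / ((u ^ 2 + a ^ 2) * (u ^ 2 + b ^ 2))) (Set.Ioi 0) := by
  refine integrableOn_Ioi_deriv_of_nonneg' (fun u _ => hasDerivAt_log_sq_add_div_sq_add hb hab u)
    (fun u hu => ?_) ((tendsto_log_sq_add_div_sq_add b (hb.trans hab)).const_mul _)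
  have := Set.mem_Ioi.1 hu
  positivity

theorem integral_Ioi_two_mul_div {a b : ℝ} (hb : 0 < b) (hab : b < a) :
    ∫ u in Set.Ioi (0 : ℝ), 2 * u / ((u ^ 2 + a ^ 2) * (u ^ 2 + b ^ 2))
      = 2 * Real.log (a / b) / (a ^ 2 - b ^ 2) := by
  rw [integral_Ioi_of_hasDerivAt_of_nonneg'
    (fun u _ => hasDerivAt_log_sq_add_div_sq_add hb hab u)
    (fun u hu => by have := Set.mem_Ioi.1 hu; positivity)
    ((tendsto_log_sq_add_div_sq_add b (hb.trans hab)).const_mul _)]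
  have h : Real.log ((0 ^ 2 + b ^ 2) / (0 ^ 2 + a ^ 2)) = -(2 * Real.log (a / b)) := by
    have : (0 ^ 2 + b ^ 2) / (0 ^ 2 + a ^ 2) = ((a / b) ^ 2)⁻¹ := by simp [div_pow]
    rw [this, Real.log_inv, Real.log_pow]
    norm_num
  rw [h]
  ring

theorem coth_sub_inv_eq_tsum {u : ℝ} (hu : 0 < u) :
    coth u - 1 / u = ∑' k : ℕ, 2 * u / (u ^ 2 + (π * ((k : ℝ) + 1)) ^ 2) := by
  have hπ : (π : ℂ) ≠ 0 := by exact_mod_cast pi_ne_zero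
  have huC : (u : ℂ) ≠ 0 := by exact_mod_cast hu.ne'
  set x : ℂ := u * Complex.I / π with hx
  have hmem : x ∈ Complex.integerComplement := by
    refine UpperHalfPlane.coe_mem_integerComplement ⟨x, ?_⟩
    have : x = ((u / π : ℝ) : ℂ) * Complex.I := by rw [hx]; push_cast; ring
    rw [this]
    simpa using div_pos hu pi_pos
  have hcot : π * Complex.cot (π * x) - 1 / x
      = -Complex.I * π * ((coth u - 1 / u : ℝ) : ℂ) := by
    have hsinh : (Real.sinh u : ℂ) ≠ 0 := by exact_mod_cast (Real.sinh_pos_iff.2 hu).ne'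
    have harg : π * x = u * Complex.I := by rw [hx]; field_simp
    rw [harg, Complex.cot, Complex.cos_mul_I, Complex.sin_mul_I, coth, hx]
    push_cast at hsinh ⊢
    field_simp
    linear_combination (u * Complex.cosh u - Complex.sinh u : ℂ) * Complex.I_sq
  have hterm (k : ℕ) : 1 / (x - (k + 1)) + 1 / (x + (k + 1))
      = -Complex.I * π * ((2 * u / (u ^ 2 + (π * ((k : ℝ) + 1)) ^ 2) : ℝ) : ℂ) := by
    have hsub : x - (k + 1) ≠ 0 := by
      simpa [sub_eq_add_neg, add_comm] using
        Complex.integerComplement_add_ne_zero hmem (-(k + 1 : ℤ))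
    have hadd : x + (k + 1) ≠ 0 := by
      simpa using Complex.integerComplement_add_ne_zero hmem (k + 1 : ℤ)
    have hden : ((u : ℂ) ^ 2 + (π * ((k : ℂ) + 1)) ^ 2) ≠ 0 := by
      have : u ^ 2 + (π * ((k : ℝ) + 1)) ^ 2 ≠ 0 := by positivity
      exact_mod_cast this
    have hux : (u : ℂ) = -Complex.I * π * x := by
      rw [hx]; field_simp; linear_combination Complex.I_sq
    push_cast
    rw [div_add_div _ _ hsub hadd, mul_div_assoc', div_eq_div_iff (mul_ne_zero hsub hadd) hden, hux]
    ring_nf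
    simp only [Complex.I_sq]
    ring
  have h := cot_series_rep' hmem
  simp_rw [hterm] at h
  rw [hcot, tsum_mul_left, ← Complex.ofReal_tsum] at h
  exact_mod_cast mul_left_cancel₀ (mul_ne_zero (neg_ne_zero.2 Complex.I_ne_zero) hπ) h

theorem summable_log_two_mul_div :
    Summable fun k : ℕ => Real.log (2 * ((k : ℝ) + 1)) / (4 * ((k : ℝ) + 1) ^ 2 - 1) := by
  have hs : Summable fun k : ℕ => 2 * (1 / ((k : ℝ) + 1) ^ (3 / 2 : ℝ)) := by
    have h := (summable_nat_add_iff 1).2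
      (Real.summable_one_div_nat_rpow.2 (by norm_num : (1 : ℝ) < 3 / 2))
    exact Summable.mul_left _ (by simpa using h)
  refine hs.of_nonneg_of_le (fun k => ?_) fun k => ?_
  · have hk : (0 : ℝ) ≤ k := k.cast_nonneg
    exact div_nonneg (Real.log_nonneg (by linarith)) (by nlinarith)
  · set y : ℝ := (k : ℝ) + 1 with hy
    have hy1 : 1 ≤ y := by simp [hy]
    have hy0 : 0 < y := by linarith
    have hlog : Real.log (2 * y) ≤ 4 * y ^ (1 / 2 : ℝ) := by
      have h1 := Real.log_le_rpow_div hy0.le (by norm_num : (0 : ℝ) < 1 / 2)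
      have h2 := Real.one_le_rpow hy1 (by norm_num : (0 : ℝ) ≤ 1 / 2)
      rw [Real.log_mul two_ne_zero hy0.ne']
      linarith [Real.log_two_lt_d9]
    have hpow : y ^ (1 / 2 : ℝ) * y ^ (3 / 2 : ℝ) = y ^ 2 := by
      rw [← Real.rpow_add hy0, ← Real.rpow_natCast]
      norm_num
    have hp : 0 < y ^ (3 / 2 : ℝ) := by positivity
    rw [mul_one_div, div_le_div_iff₀ (by nlinarith) hp]
    nlinarith [mul_le_mul_of_nonneg_right hlog hp.le]

/-- The improper integral `∫₀^∞ (coth u − 1/u)/(u² + π²/4) du` converges and equals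
`(8/π²) · Σ_{k=1}^∞ ln(2k)/(4k² − 1)`. -/
theorem Jplus_series_representation :
    IntegrableOn (fun u : ℝ => (coth u - 1 / u) / (u ^ 2 + Real.pi ^ 2 / 4)) (Set.Ioi 0) ∧
    ∫ u in Set.Ioi (0 : ℝ), (coth u - 1 / u) / (u ^ 2 + Real.pi ^ 2 / 4)
      = (8 / Real.pi ^ 2) *
        ∑' k : ℕ, Real.log (2 * ((k : ℝ) + 1)) / (4 * ((k : ℝ) + 1) ^ 2 - 1) := by
  have hint (k : ℕ) : IntegrableOn (fun u : ℝ =>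
      2 * u / ((u ^ 2 + (π * ((k : ℝ) + 1)) ^ 2) * (u ^ 2 + (π / 2) ^ 2))) (Set.Ioi 0) :=
    integrableOn_Ioi_two_mul_div (by positivity) (by nlinarith [pi_pos, k.cast_nonneg (α := ℝ)])
  have hval (k : ℕ) : ∫ u in Set.Ioi (0 : ℝ),
      2 * u / ((u ^ 2 + (π * ((k : ℝ) + 1)) ^ 2) * (u ^ 2 + (π / 2) ^ 2))
        = 8 / π ^ 2 * (Real.log (2 * ((k : ℝ) + 1)) / (4 * ((k : ℝ) + 1) ^ 2 - 1)) := by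
    have hk : (0 : ℝ) ≤ k := k.cast_nonneg
    rw [integral_Ioi_two_mul_div (by positivity) (by nlinarith [pi_pos])]
    have harg : π * ((k : ℝ) + 1) / (π / 2) = 2 * ((k : ℝ) + 1) := by field_simp
    have hden : (π * ((k : ℝ) + 1)) ^ 2 - (π / 2) ^ 2
        = π ^ 2 / 4 * (4 * ((k : ℝ) + 1) ^ 2 - 1) := by ring
    have hne : 4 * ((k : ℝ) + 1) ^ 2 - 1 ≠ 0 := by nlinarith
    rw [harg, hden]
    field_simp
    ring
  have hnorm (k : ℕ) : ∫ u in Set.Ioi (0 : ℝ),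
      ‖2 * u / ((u ^ 2 + (π * ((k : ℝ) + 1)) ^ 2) * (u ^ 2 + (π / 2) ^ 2))‖
        = 8 / π ^ 2 * (Real.log (2 * ((k : ℝ) + 1)) / (4 * ((k : ℝ) + 1) ^ 2 - 1)) := by
    rw [← hval k]
    refine setIntegral_congr_fun measurableSet_Ioi fun u hu => ?_
    have := Set.mem_Ioi.1 hu
    exact Real.norm_of_nonneg (by positivity)
  have hsum := integral_tsum_of_summable_integral_norm hint
    (by simpa only [hnorm] using summable_log_two_mul_div.mul_left _)
  simp only [hval, tsum_mul_left] at hsum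
  have heq : ∫ u in Set.Ioi (0 : ℝ), (coth u - 1 / u) / (u ^ 2 + π ^ 2 / 4)
      = 8 / π ^ 2 * ∑' k : ℕ, Real.log (2 * ((k : ℝ) + 1)) / (4 * ((k : ℝ) + 1) ^ 2 - 1) := by
    rw [hsum]
    refine setIntegral_congr_fun measurableSet_Ioi fun u hu => ?_
    simp only [coth_sub_inv_eq_tsum hu, ← div_div, tsum_div_const]
    norm_num [div_pow]
  refine ⟨?_, heq⟩
  have hpos : 0 < ∑' k : ℕ, Real.log (2 * ((k : ℝ) + 1)) / (4 * ((k : ℝ) + 1) ^ 2 - 1) := by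
    refine summable_log_two_mul_div.tsum_pos (fun k => ?_) 0 ?_
    · have hk : (0 : ℝ) ≤ k := k.cast_nonneg
      exact div_nonneg (Real.log_nonneg (by linarith)) (by nlinarith)
    · norm_num
      positivity
  -- A non-integrable function would have integral zero.
  refine Integrable.of_integral_ne_zero ?_
  rw [heq]
  positivity
end

section
/- For all real p > 0 and 0 < z ≤ z', the integral ∫₀^∞ k·J₀(kz)·J₀(kz')/(p² + k²) dk converges and equals I₀(pz)·K₀(pz'), where J₀ is the Bessel function of the first kind of order 0, and I₀, K₀ are the modified Bessel functions of order 0. -/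
open MeasureTheory Real

/-- The Bessel function of the first kind of order 0,
`J₀(x) = (1/π) ∫₀^π cos(x sin θ) dθ`. -/
noncomputable def besselJ0 (x : ℝ) : ℝ :=
  (1 / Real.pi) * ∫ θ in (0:ℝ)..Real.pi, Real.cos (x * Real.sin θ)

/-- The modified Bessel function of the first kind of order 0,
`I₀(x) = (1/π) ∫₀^π cosh(x cos θ) dθ`. -/
noncomputable def besselI0 (x : ℝ) : ℝ :=
  (1 / Real.pi) * ∫ θ in (0:ℝ)..Real.pi, Real.cosh (x * Real.cos θ)

/-- The modified Bessel function of the second kind of order 0,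
`K₀(x) = ∫₀^∞ e^{−x cosh t} dt`. -/
noncomputable def besselK0 (x : ℝ) : ℝ :=
  ∫ t in Set.Ioi (0:ℝ), Real.exp (-(x * Real.cosh t))

open Set Filter Topology

lemma integral_Ioo_neg_pi_pi_eq_intervalIntegral (f : ℝ → ℂ) :
    ∫ θ in Ioo (-π) π, f θ = ∫ θ in (-π)..π, f θ := by
  rw [intervalIntegral.integral_of_le (by linarith [pi_pos]), integral_Ioc_eq_integral_Ioo]

lemma integral_Ioo_neg_pi_pi_comp_sub {f : ℝ → ℂ} (hf : Function.Periodic f (2 * π)) (α : ℝ) :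
    ∫ θ in Ioo (-π) π, f (θ - α) = ∫ θ in Ioo (-π) π, f θ := by
  simp_rw [integral_Ioo_neg_pi_pi_eq_intervalIntegral]
  rw [intervalIntegral.integral_comp_sub_right]
  have h := hf.intervalIntegral_add_eq (-π - α) (-π)
  rwa [show -π - α + 2 * π = π - α by ring, show -π + 2 * π = π by ring] at h

lemma integral_Ioo_neg_pi_pi_eq_integral_add {f : ℝ → ℂ} (hf : Continuous f) :
    ∫ θ in Ioo (-π) π, f θ = ∫ θ in (0 : ℝ)..π, (f θ + f (-θ)) := by
  rw [integral_Ioo_neg_pi_pi_eq_intervalIntegral,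
    ← intervalIntegral.integral_add_adjacent_intervals (b := 0)
      (hf.intervalIntegrable _ _) (hf.intervalIntegrable _ _),
    intervalIntegral.integral_add (g := fun θ => f (-θ)) (hf.intervalIntegrable _ _)
      ((hf.comp continuous_neg).intervalIntegrable _ _),
    intervalIntegral.integral_comp_neg (fun θ => f θ), neg_zero, add_comm]

lemma integral_cexp_mul_cos_sub (x α : ℝ) :
    ∫ θ in Ioo (-π) π, Complex.exp ((x * cos (θ - α) : ℝ) * Complex.I) =
      2 * π * besselJ0 x := by
  have hper (β : ℝ) : Function.Periodic
      (fun θ : ℝ => Complex.exp ((x * cos (θ - β) : ℝ) * Complex.I)) (2 * π) := fun θ => by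
    have : θ + 2 * π - β = θ - β + 2 * π := by ring
    simp only [this, cos_add_two_pi]
  have h0 : ∫ θ in Ioo (-π) π, Complex.exp ((x * cos (θ - α) : ℝ) * Complex.I) =
      ∫ θ in Ioo (-π) π, Complex.exp ((x * sin θ : ℝ) * Complex.I) := by
    have h1 := integral_Ioo_neg_pi_pi_comp_sub (hper 0) α
    have h2 := integral_Ioo_neg_pi_pi_comp_sub (hper 0) (π / 2)
    simp only [sub_zero, cos_sub_pi_div_two] at h1 h2
    rw [h1, h2]
  rw [h0, integral_Ioo_neg_pi_pi_eq_integral_add (by fun_prop), besselJ0]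
  have h3 : ∀ θ : ℝ, Complex.exp ((x * sin θ : ℝ) * Complex.I) +
      Complex.exp ((x * sin (-θ) : ℝ) * Complex.I) = ((2 * cos (x * sin θ) : ℝ) : ℂ) := fun θ => by
    push_cast
    rw [Complex.two_cos]
    simp
  simp_rw [h3]
  rw [intervalIntegral.integral_ofReal, intervalIntegral.integral_const_mul]
  push_cast
  have : (π : ℂ) ≠ 0 := by exact_mod_cast pi_ne_zero
  field_simp

lemma continuous_besselJ0 : Continuous besselJ0 := by
  unfold besselJ0
  refine continuous_const.mul
    (intervalIntegral.continuous_parametric_intervalIntegral_of_continuous' ?_ _ _)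
  fun_prop

lemma abs_besselJ0_le_one (x : ℝ) : |besselJ0 x| ≤ 1 := by
  have h : ‖∫ θ in (0 : ℝ)..π, cos (x * sin θ)‖ ≤ 1 * |π - 0| :=
    intervalIntegral.norm_integral_le_of_norm_le_const fun θ _ => abs_cos_le_one _
  rw [besselJ0, abs_mul, abs_of_pos (by positivity), ← Real.norm_eq_abs]
  rw [sub_zero, abs_of_pos pi_pos, one_mul] at h
  rwa [one_div, inv_mul_le_one₀ pi_pos]

lemma integral_gaussian_fourier {s : ℝ} (hs : 0 < s) (X : ℝ) :
    ∫ x : ℝ, Complex.exp ((x * X : ℝ) * Complex.I) * (exp (-s * x ^ 2) : ℝ) =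
      (√(π / s) * exp (-X ^ 2 / (4 * s)) : ℝ) := by
  have h := fourierIntegral_gaussian (b := (s : ℂ)) (by simpa using hs) (X : ℂ)
  rw [show ((1 / 2 : ℂ)) = ((1 / 2 : ℝ) : ℂ) by norm_num] at h
  rw [Real.sqrt_eq_rpow]
  push_cast [Complex.ofReal_cpow (by positivity : (0 : ℝ) ≤ π / s)]
  convert h using 1
  · refine integral_congr_ae (.of_forall fun x => ?_)
    simp only
    ring_nf
  · norm_num

lemma integral_polar_gaussian_fourier {s : ℝ} (hs : 0 < s) (X Y : ℝ) :
    ∫ q in Ioi (0 : ℝ) ×ˢ Ioo (-π) π,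
        (q.1 * exp (-s * q.1 ^ 2) : ℝ) *
          Complex.exp ((q.1 * (X * cos q.2 + Y * sin q.2) : ℝ) * Complex.I) =
      (π / s * exp (-(X ^ 2 + Y ^ 2) / (4 * s)) : ℝ) := by
  have h := integral_comp_polarCoord_symm (fun v : ℝ × ℝ =>
    (Complex.exp ((v.1 * X : ℝ) * Complex.I) * (exp (-s * v.1 ^ 2) : ℝ)) *
    (Complex.exp ((v.2 * Y : ℝ) * Complex.I) * (exp (-s * v.2 ^ 2) : ℝ)))
  have hprod := integral_prod_mul (μ := (volume : Measure ℝ)) (ν := (volume : Measure ℝ))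
    (fun x : ℝ => Complex.exp ((x * X : ℝ) * Complex.I) * (exp (-s * x ^ 2) : ℝ))
    (fun x : ℝ => Complex.exp ((x * Y : ℝ) * Complex.I) * (exp (-s * x ^ 2) : ℝ))
  rw [← Measure.volume_eq_prod, integral_gaussian_fourier hs, integral_gaussian_fourier hs] at hprod
  rw [hprod, polarCoord_target] at h
  convert h using 1
  · refine integral_congr_ae (.of_forall fun q => ?_)
    simp only [polarCoord_symm_apply, Complex.real_smul]
    have hc : exp (-s * q.1 ^ 2) =
        exp (-s * (q.1 * cos q.2) ^ 2) * exp (-s * (q.1 * sin q.2) ^ 2) := by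
      rw [← exp_add]
      congr 1
      linear_combination s * q.1 ^ 2 * cos_sq_add_sin_sq q.2
    have he : Complex.exp ((q.1 * (X * cos q.2 + Y * sin q.2) : ℝ) * Complex.I) =
        Complex.exp ((q.1 * cos q.2 * X : ℝ) * Complex.I) *
          Complex.exp ((q.1 * sin q.2 * Y : ℝ) * Complex.I) := by
      rw [← Complex.exp_add]
      congr 1
      push_cast
      ring
    rw [hc, he, Complex.ofReal_mul, Complex.ofReal_mul]
    ring
  · rw [← Complex.ofReal_mul]
    congr 1
    have : √(π / s) * √(π / s) = π / s := mul_self_sqrt (by positivity)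
    rw [show -(X ^ 2 + Y ^ 2) / (4 * s) = -X ^ 2 / (4 * s) + -Y ^ 2 / (4 * s) by ring, exp_add]
    linear_combination -exp (-X ^ 2 / (4 * s)) * exp (-Y ^ 2 / (4 * s)) * this

lemma integrableOn_mul_exp_neg_mul_sq {s : ℝ} (hs : 0 < s) :
    IntegrableOn (fun k : ℝ => k * exp (-s * k ^ 2)) (Ioi 0) :=
  (integrable_mul_exp_neg_mul_sq hs).integrableOn

/-- Weber's second exponential integral. -/
lemma integral_mul_exp_neg_mul_sq_mul_besselJ0_mul_besselJ0 {s : ℝ} (hs : 0 < s) (z z' : ℝ) :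
    ∫ k in Ioi (0 : ℝ), k * exp (-s * k ^ 2) * (besselJ0 (k * z) * besselJ0 (k * z')) =
      1 / (4 * π * s) *
        ∫ φ in Ioo (-π) π, exp (-((z' + z * cos φ) ^ 2 + (z * sin φ) ^ 2) / (4 * s)) := by
  set μ := (volume : Measure ℝ).restrict (Ioi 0)
  set ν := (volume : Measure ℝ).restrict (Ioo (-π) π)
  set H : ℝ → ℝ × ℝ → ℂ := fun φ q => (q.1 * exp (-s * q.1 ^ 2) : ℝ) *
    Complex.exp ((q.1 * ((z' + z * cos φ) * cos q.2 + z * sin φ * sin q.2) : ℝ) * Complex.I)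
  have hμν : (volume : Measure (ℝ × ℝ)).restrict (Ioi 0 ×ˢ Ioo (-π) π) = μ.prod ν := by
    rw [Measure.volume_eq_prod, Measure.prod_restrict]
  have hH : Integrable (Function.uncurry H) (ν.prod (μ.prod ν)) := by
    have hg : Integrable (fun v : ℝ × ℝ × ℝ => (1 : ℝ) * (v.2.1 * exp (-s * v.2.1 ^ 2) * 1))
        (ν.prod (μ.prod ν)) :=
      (integrable_const (1 : ℝ)).mul_prod
        ((integrableOn_mul_exp_neg_mul_sq hs).mul_prod (integrable_const (1 : ℝ)))
    refine hg.norm.mono' (Continuous.aestronglyMeasurable (by fun_prop)) (.of_forall fun v => ?_)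
    simp only [Function.uncurry, H, norm_mul, Complex.norm_exp_ofReal_mul_I, Complex.norm_real]
    simp
  have hleft (φ : ℝ) : ∫ q, H φ q ∂(μ.prod ν) =
      (π / s * exp (-((z' + z * cos φ) ^ 2 + (z * sin φ) ^ 2) / (4 * s)) : ℝ) := by
    rw [← hμν]
    exact integral_polar_gaussian_fourier hs _ _
  have hright (q : ℝ × ℝ) : ∫ φ, H φ q ∂ν = (q.1 * exp (-s * q.1 ^ 2) : ℝ) *
      (Complex.exp ((q.1 * z' * cos (q.2 - 0) : ℝ) * Complex.I) *
        (2 * π * besselJ0 (q.1 * z))) := by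
    rw [← integral_cexp_mul_cos_sub _ q.2, ← integral_const_mul, ← integral_const_mul]
    refine integral_congr_ae (.of_forall fun φ => ?_)
    simp only [H]
    rw [← Complex.exp_add]
    congr 2
    rw [sub_zero, cos_sub]
    push_cast
    ring
  have hswap := integral_integral_swap hH
  have hint := hH.integral_prod_right
  simp only [Function.uncurry_apply_pair] at hint
  simp_rw [hleft] at hswap
  rw [integral_prod _ hint] at hswap
  simp_rw [hright] at hswap
  have hθ (k : ℝ) : ∫ θ, ((k * exp (-s * k ^ 2) : ℝ) : ℂ) *
      (Complex.exp ((k * z' * cos (θ - 0) : ℝ) * Complex.I) * (2 * π * besselJ0 (k * z))) ∂ν =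
      ((4 * π ^ 2 * (k * exp (-s * k ^ 2) * (besselJ0 (k * z) * besselJ0 (k * z'))) : ℝ) : ℂ) := by
    rw [integral_const_mul, integral_mul_const, integral_cexp_mul_cos_sub]
    push_cast
    ring
  simp_rw [hθ] at hswap
  rw [integral_complex_ofReal, integral_complex_ofReal, Complex.ofReal_inj,
    integral_const_mul, integral_const_mul] at hswap
  have hπ := pi_pos
  field_simp at hswap ⊢
  linarith

lemma exp_neg_mul_one_add_cos_le {a φ : ℝ} (ha : 0 ≤ a) (hφ : φ ∈ Ioo (-π) π) :
    exp (-(a * (1 + cos φ))) ≤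
      exp (-(2 * a / π ^ 2) * (φ - π) ^ 2) + exp (-(2 * a / π ^ 2) * (φ + π) ^ 2) := by
  have hcos : 1 + cos φ = 2 * cos (φ / 2) ^ 2 := by
    rw [cos_sq]
    ring_nf
  have hπ := pi_pos
  have key {x : ℝ} (h0 : 0 ≤ x) (hx : x ≤ cos (φ / 2)) :
      exp (-(a * (1 + cos φ))) ≤ exp (-(2 * a) * x ^ 2) := by
    rw [hcos]
    apply exp_le_exp.mpr
    have : x ^ 2 ≤ cos (φ / 2) ^ 2 := by gcongr
    nlinarith [mul_le_mul_of_nonneg_left this ha]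
  rcases le_total 0 φ with h | h
  · have h1 := one_sub_mul_le_cos (x := φ / 2) (by linarith) (by linarith [hφ.2])
    have h2 : 0 ≤ 1 - 2 / π * (φ / 2) := by
      field_simp
      linarith [hφ.2]
    refine (key h2 h1).trans (le_add_of_le_of_nonneg (le_of_eq ?_) (exp_pos _).le)
    congr 1
    field_simp
    ring
  · have h1 := one_add_mul_le_cos (x := φ / 2) (by linarith [hφ.1]) (by linarith)
    have h2 : 0 ≤ 1 + 2 / π * (φ / 2) := by
      field_simp
      linarith [hφ.1]
    refine (key h2 h1).trans (le_add_of_nonneg_of_le (exp_pos _).le (le_of_eq ?_))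
    congr 1
    field_simp
    ring

lemma integrableOn_Ioo_neg_pi_pi {E : Type*} [NormedAddCommGroup E] {f : ℝ → E}
    (hf : Continuous f) : IntegrableOn f (Ioo (-π) π) :=
  (hf.integrableOn_Icc).mono_set Ioo_subset_Icc_self

lemma integral_exp_neg_mul_one_add_cos_le {a : ℝ} (ha : 0 < a) :
    ∫ φ in Ioo (-π) π, exp (-(a * (1 + cos φ))) ≤ 2 * √(π / (2 * a / π ^ 2)) := by
  have hb : 0 < 2 * a / π ^ 2 := by positivity
  have hi1 : Integrable (fun φ : ℝ => exp (-(2 * a / π ^ 2) * (φ - π) ^ 2)) :=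
    (integrable_exp_neg_mul_sq hb).comp_sub_right π
  have hi2 : Integrable (fun φ : ℝ => exp (-(2 * a / π ^ 2) * (φ + π) ^ 2)) :=
    (integrable_exp_neg_mul_sq hb).comp_add_right π
  calc ∫ φ in Ioo (-π) π, exp (-(a * (1 + cos φ)))
      ≤ ∫ φ in Ioo (-π) π, (exp (-(2 * a / π ^ 2) * (φ - π) ^ 2) +
          exp (-(2 * a / π ^ 2) * (φ + π) ^ 2)) :=
        setIntegral_mono_on (integrableOn_Ioo_neg_pi_pi (by fun_prop))
          (hi1.add hi2).integrableOn measurableSet_Ioo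
          fun φ hφ => exp_neg_mul_one_add_cos_le ha.le hφ
    _ ≤ ∫ φ, (exp (-(2 * a / π ^ 2) * (φ - π) ^ 2) +
          exp (-(2 * a / π ^ 2) * (φ + π) ^ 2)) :=
        setIntegral_le_integral (hi1.add hi2) (.of_forall fun φ => by positivity)
    _ = 2 * √(π / (2 * a / π ^ 2)) := by
        rw [integral_add hi1 hi2,
          integral_sub_right_eq_self (fun φ => exp (-(2 * a / π ^ 2) * φ ^ 2)),
          integral_add_right_eq_self (fun φ => exp (-(2 * a / π ^ 2) * φ ^ 2)),
          integral_gaussian]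
        ring

lemma integrable_heat_kernel_mul_besselJ0_sq {p z : ℝ} (hp : 0 < p) (hz : 0 < z) :
    Integrable (fun v : ℝ × ℝ => exp (-v.1 * p ^ 2) *
        (v.2 * exp (-v.1 * v.2 ^ 2) * (besselJ0 (v.2 * z) * besselJ0 (v.2 * z))))
      ((volume.restrict (Ioi 0)).prod (volume.restrict (Ioi 0))) := by
  have hJ := continuous_besselJ0
  rw [integrable_prod_iff (Continuous.aestronglyMeasurable (by fun_prop))]
  constructor
  · refine (ae_restrict_iff' measurableSet_Ioi).mpr (.of_forall fun s hs => ?_)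
    refine ((Integrable.mul_bdd (c := 1)
      (f := fun k : ℝ => k * exp (-s * k ^ 2)) (g := fun k => besselJ0 (k * z) * besselJ0 (k * z))
      (integrableOn_mul_exp_neg_mul_sq hs) (Continuous.aestronglyMeasurable (by fun_prop))
      (.of_forall fun k => ?_))).const_mul (exp (-s * p ^ 2))
    rw [norm_mul, ← one_mul (1 : ℝ)]
    exact mul_le_mul (abs_besselJ0_le_one _) (abs_besselJ0_le_one _) (norm_nonneg _) zero_le_one
  · have hdom : IntegrableOn (fun s : ℝ => √(π ^ 3 / z ^ 2) / (2 * π) *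
        (s ^ (-1 / 2 : ℝ) * exp (-p ^ 2 * s ^ (1 : ℝ)))) (Ioi 0) :=
      (integrableOn_rpow_mul_exp_neg_mul_rpow (by norm_num) one_pos (by positivity)).const_mul _
    refine hdom.mono' ?_ ?_
    · refine AEStronglyMeasurable.integral_prod_right'
        (f := fun v : ℝ × ℝ => ‖exp (-v.1 * p ^ 2) *
        (v.2 * exp (-v.1 * v.2 ^ 2) * (besselJ0 (v.2 * z) * besselJ0 (v.2 * z)))‖) ?_
      exact Continuous.aestronglyMeasurable (by fun_prop)
    · refine (ae_restrict_iff' measurableSet_Ioi).mpr (.of_forall fun s (hs : 0 < s) => ?_)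
      have hnorm : ∫ k in Ioi (0 : ℝ), ‖exp (-s * p ^ 2) *
          (k * exp (-s * k ^ 2) * (besselJ0 (k * z) * besselJ0 (k * z)))‖ =
          exp (-s * p ^ 2) * (1 / (4 * π * s) *
            ∫ φ in Ioo (-π) π, exp (-((z ^ 2 / (2 * s)) * (1 + cos φ)))) := by
        have hW : ∫ φ in Ioo (-π) π, exp (-((z ^ 2 / (2 * s)) * (1 + cos φ))) =
            ∫ φ in Ioo (-π) π, exp (-((z + z * cos φ) ^ 2 + (z * sin φ) ^ 2) / (4 * s)) := by
          refine integral_congr_ae (.of_forall fun φ => ?_)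
          simp only
          congr 1
          field_simp
          linear_combination 2 * sin_sq_add_cos_sq φ
        rw [hW, ← integral_mul_exp_neg_mul_sq_mul_besselJ0_mul_besselJ0 hs, ← integral_const_mul]
        refine setIntegral_congr_fun measurableSet_Ioi fun k (hk : 0 < k) => ?_
        rw [norm_of_nonneg]
        have := mul_self_nonneg (besselJ0 (k * z))
        positivity
      simp only
      rw [hnorm, norm_of_nonneg (mul_nonneg (exp_pos _).le (mul_nonneg (by positivity)
        (integral_nonneg fun φ => (exp_pos _).le)))]
      have hle := integral_exp_neg_mul_one_add_cos_le (a := z ^ 2 / (2 * s)) (by positivity)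
      have hsq : √(π / (2 * (z ^ 2 / (2 * s)) / π ^ 2)) = √(π ^ 3 / z ^ 2) * √s := by
        rw [← sqrt_mul (by positivity)]
        congr 1
        field_simp
      rw [hsq] at hle
      have hpow : s ^ (-1 / 2 : ℝ) = √s / s := by
        rw [sqrt_eq_rpow, ← rpow_sub_one hs.ne']
        norm_num
      rw [hpow, rpow_one, show -p ^ 2 * s = -s * p ^ 2 by ring]
      calc _ ≤ exp (-s * p ^ 2) * (1 / (4 * π * s) * (2 * (√(π ^ 3 / z ^ 2) * √s))) := by
            gcongr
        _ = _ := by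
            field_simp
            ring

lemma integrable_heat_kernel_mul_besselJ0_mul_besselJ0 {p z z' : ℝ} (hp : 0 < p) (hz : 0 < z)
    (hz' : 0 < z') :
    Integrable (fun v : ℝ × ℝ => exp (-v.1 * p ^ 2) *
        (v.2 * exp (-v.1 * v.2 ^ 2) * (besselJ0 (v.2 * z) * besselJ0 (v.2 * z'))))
      ((volume.restrict (Ioi 0)).prod (volume.restrict (Ioi 0))) := by
  have hJ := continuous_besselJ0
  refine ((integrable_heat_kernel_mul_besselJ0_sq hp hz).norm.add
    (integrable_heat_kernel_mul_besselJ0_sq hp hz').norm).mono'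
      (Continuous.aestronglyMeasurable (by fun_prop)) (.of_forall fun v => ?_)
  simp only [norm_mul, Pi.add_apply, ← mul_add]
  gcongr
  nlinarith [sq_nonneg (‖besselJ0 (v.2 * z)‖ - ‖besselJ0 (v.2 * z')‖),
    sq_nonneg (‖besselJ0 (v.2 * z)‖ + ‖besselJ0 (v.2 * z')‖)]

lemma integral_heat_kernel_mul {p : ℝ} (hp : 0 < p) (k c : ℝ) :
    ∫ s in Ioi (0 : ℝ), exp (-s * p ^ 2) * (k * exp (-s * k ^ 2) * c) =
      k * c / (p ^ 2 + k ^ 2) := by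
  have hpos : 0 < p ^ 2 + k ^ 2 := by positivity
  have h := integral_exp_mul_Ioi (a := -(p ^ 2 + k ^ 2)) (by linarith) 0
  rw [mul_zero, exp_zero, neg_div_neg_eq] at h
  rw [mul_div_assoc, div_eq_mul_one_div c, ← h, ← integral_const_mul, ← integral_const_mul]
  refine integral_congr_ae (.of_forall fun s => ?_)
  simp only
  rw [show -(p ^ 2 + k ^ 2) * s = -s * p ^ 2 + -s * k ^ 2 by ring, exp_add]
  ring

lemma one_add_sq_div_two_le_cosh (x : ℝ) : 1 + x ^ 2 / 2 ≤ cosh x := by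
  have h2 : cosh x = 1 + 2 * sinh (x / 2) ^ 2 := by
    have := cosh_two_mul (x / 2)
    rw [mul_div_cancel₀ x two_ne_zero, cosh_sq] at this
    linarith
  have h3 : (x / 2) ^ 2 ≤ sinh (x / 2) ^ 2 := by
    rw [sq_le_sq, abs_sinh]
    exact self_le_sinh_iff.mpr (abs_nonneg _)
  nlinarith

lemma integrable_exp_neg_mul_cosh {a : ℝ} (ha : 0 < a) :
    Integrable (fun t : ℝ => exp (-(a * cosh t))) := by
  refine (integrable_exp_neg_mul_sq (half_pos ha)).mono'
    (Continuous.aestronglyMeasurable (by fun_prop)) (.of_forall fun t => ?_)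
  rw [norm_of_nonneg (exp_pos _).le]
  exact exp_le_exp.mpr (by nlinarith [one_add_sq_div_two_le_cosh t])

lemma tendsto_exp_neg_mul_cosh_atTop {a : ℝ} (ha : 0 < a) :
    Tendsto (fun t : ℝ => exp (-(a * cosh t))) atTop (𝓝 0) := by
  refine tendsto_exp_neg_atTop_nhds_zero.comp (Tendsto.const_mul_atTop ha ?_)
  refine tendsto_atTop_mono (fun t => (by linarith [one_add_sq_div_two_le_cosh t] :
    t ^ 2 / 2 ≤ cosh t)) ?_
  exact (tendsto_pow_atTop two_ne_zero).atTop_div_const two_pos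

lemma cosh_ofReal_add_ofReal_mul_I (t α : ℝ) :
    Complex.cosh (t + α * Complex.I) =
      (cosh t * cos α : ℝ) + (sinh t * sin α : ℝ) * Complex.I := by
  rw [Complex.cosh_add, Complex.cosh_mul_I, Complex.sinh_mul_I]
  push_cast
  ring

lemma norm_cexp_neg_mul_cosh (c t α : ℝ) :
    ‖Complex.exp (-(c * Complex.cosh (t + α * Complex.I)))‖ = exp (-(c * cos α * cosh t)) := by
  rw [Complex.norm_exp, cosh_ofReal_add_ofReal_mul_I]
  congr 1
  simp only [Complex.neg_re, Complex.re_ofReal_mul, Complex.add_re, Complex.ofReal_re,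
    Complex.I_re]
  ring

lemma integral_cexp_neg_mul_cosh_add_mul_I {c α : ℝ} (hc : 0 < c) (hα : |α| < π / 2) :
    ∫ t : ℝ, Complex.exp (-(c * Complex.cosh (t + α * Complex.I))) =
      ∫ t : ℝ, Complex.exp (-(c * Complex.cosh t)) := by
  set f : ℂ → ℂ := fun w => Complex.exp (-(c * Complex.cosh w))
  have hf : Differentiable ℂ f := by fun_prop
  have hcos : 0 < cos α := cos_pos_of_mem_Ioo ⟨by linarith [abs_lt.mp hα],
    by linarith [abs_lt.mp hα]⟩
  have hint {β : ℝ} (hβ : 0 < cos β) : Integrable (fun t : ℝ => f (t + β * Complex.I)) := by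
    refine (integrable_exp_neg_mul_cosh (mul_pos hc hβ)).mono'
      (Continuous.aestronglyMeasurable (by fun_prop)) (.of_forall fun t => ?_)
    exact (norm_cexp_neg_mul_cosh c t β).le
  have hside {T y : ℝ} (hy : y ∈ uIoc 0 α) :
      ‖f (T + y * Complex.I)‖ ≤ exp (-(c * cos α * cosh T)) := by
    rw [norm_cexp_neg_mul_cosh]
    have hyα : |y| ≤ |α| := by
      rcases mem_uIoc.mp hy with h | h
      · rw [abs_of_pos h.1]; exact h.2.trans (le_abs_self _)
      · rw [abs_of_nonpos h.2]; exact (neg_le_neg h.1.le).trans (neg_le_abs _)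
    have : cos α ≤ cos y := by
      rw [← cos_abs α, ← cos_abs y]
      exact cos_le_cos_of_nonneg_of_le_pi (abs_nonneg _) (by linarith [pi_pos]) hyα
    have := cosh_pos T
    gcongr
  have hlim (σ : ℝ → ℝ) (hσ : ∀ T, cosh (σ T) = cosh T) :
      Tendsto (fun T => ∫ y in (0 : ℝ)..α, f (σ T + y * Complex.I)) atTop (𝓝 0) := by
    refine squeeze_zero_norm (a := fun T => exp (-(c * cos α * cosh T)) * |α - 0|) (fun T => ?_) ?_
    · refine intervalIntegral.norm_integral_le_of_norm_le_const fun y hy => ?_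
      rw [← hσ T]
      exact hside hy
    · simpa using (tendsto_exp_neg_mul_cosh_atTop (mul_pos hc hcos)).mul_const |α - 0|
  have hrect (T : ℝ) : (∫ x in (-T)..T, f (x + α * Complex.I)) =
      (∫ x in (-T)..T, f (x + (0 : ℝ) * Complex.I)) +
        Complex.I * (∫ y in (0 : ℝ)..α, f (T + y * Complex.I)) -
        Complex.I * ∫ y in (0 : ℝ)..α, f ((-T : ℝ) + y * Complex.I) := by
    have h := Complex.integral_boundary_rect_eq_zero_of_differentiableOn f
      (-T : ℝ) (T + α * Complex.I) hf.differentiableOn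
    simp only [Complex.ofReal_re, Complex.ofReal_im, Complex.add_re, Complex.add_im,
      Complex.re_ofReal_mul, Complex.im_ofReal_mul, Complex.I_re, Complex.I_im, mul_zero, mul_one,
      add_zero, zero_add, smul_eq_mul] at h
    linear_combination -h
  have h1 := intervalIntegral_tendsto_integral (hint hcos) tendsto_neg_atTop_atBot tendsto_id
  have h2 := ((intervalIntegral_tendsto_integral (hint (β := 0) (by simp))
    tendsto_neg_atTop_atBot tendsto_id).add ((hlim id fun _ => rfl).const_mul Complex.I)).sub
    ((hlim (fun T => -T) cosh_neg).const_mul Complex.I)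
  have h3 := tendsto_nhds_unique (h1.congr fun T => hrect T) h2
  simpa using h3

lemma integral_Ioo_cexp_neg_mul_cosh (a t : ℝ) :
    ∫ φ in Ioo (-π) π, Complex.exp (-(a * Complex.cosh (t + φ * Complex.I))) =
      2 * π * besselI0 a := by
  set f : ℂ → ℂ := fun w => Complex.exp (-(a * Complex.cosh w))
  have hf : Differentiable ℂ f := by fun_prop
  have hper (x : ℝ) : f (x + (-π : ℝ) * Complex.I) = f (x + π * Complex.I) := by
    simp only [f, cosh_ofReal_add_ofReal_mul_I, cos_neg, sin_neg, sin_pi, neg_zero]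
  have hshift : ∫ φ in Ioo (-π) π, f (t + φ * Complex.I) =
      ∫ φ in Ioo (-π) π, f ((0 : ℝ) + φ * Complex.I) := by
    have h := Complex.integral_boundary_rect_eq_zero_of_differentiableOn f
      ((0 : ℝ) + (-π : ℝ) * Complex.I) (t + π * Complex.I) hf.differentiableOn
    simp only [Complex.ofReal_re, Complex.ofReal_im, Complex.add_re, Complex.add_im,
      Complex.re_ofReal_mul, Complex.im_ofReal_mul, Complex.I_re, Complex.I_im, mul_zero, mul_one,
      add_zero, zero_add, smul_eq_mul, hper, sub_self] at h
    simp_rw [integral_Ioo_neg_pi_pi_eq_intervalIntegral]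
    rw [← mul_sub] at h
    exact sub_eq_zero.mp ((mul_eq_zero.mp h).resolve_left Complex.I_ne_zero)
  have hfφ (φ : ℝ) : f ((0 : ℝ) + φ * Complex.I) = (exp (-(a * cos φ)) : ℝ) := by
    simp only [f, cosh_ofReal_add_ofReal_mul_I]
    simp
  have hg : Continuous fun φ : ℝ => ((exp (-(a * cos φ)) : ℝ) : ℂ) := by fun_prop
  have hflip : ∫ φ in (0 : ℝ)..π, exp (a * cos φ) = ∫ φ in (0 : ℝ)..π, exp (-(a * cos φ)) := by
    have h := intervalIntegral.integral_comp_sub_left (a := 0) (b := π)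
      (fun φ => exp (-(a * cos φ))) π
    simpa [cos_pi_sub] using h
  rw [hshift]
  simp_rw [hfφ]
  rw [integral_Ioo_neg_pi_pi_eq_integral_add hg, besselI0]
  simp_rw [cos_neg, ← two_mul, cosh_eq]
  rw [intervalIntegral.integral_div, intervalIntegral.integral_add
    (Continuous.intervalIntegrable (by fun_prop) _ _)
    (Continuous.intervalIntegrable (by fun_prop) _ _), hflip, intervalIntegral.integral_const_mul,
    intervalIntegral.integral_ofReal]
  push_cast
  have : (π : ℂ) ≠ 0 := by exact_mod_cast pi_ne_zero
  field_simp
  ring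

lemma integral_exp_div_eq_integral_exp_neg_mul_cosh {p R : ℝ} (hp : 0 < p) (hR : 0 < R) :
    ∫ s in Ioi (0 : ℝ), exp (-s * p ^ 2) * exp (-R ^ 2 / (4 * s)) / s =
      ∫ t : ℝ, exp (-(p * R * cosh t)) := by
  have hderiv (t : ℝ) : HasDerivAt (fun t => R / (2 * p) * exp t) (R / (2 * p) * exp t) t :=
    (hasDerivAt_exp t).const_mul _
  have hinj : Function.Injective fun t => R / (2 * p) * exp t := fun t u h =>
    exp_injective (mul_left_cancel₀ (by positivity) h)
  have hrange : (fun t => R / (2 * p) * exp t) '' univ = Ioi 0 := by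
    ext s
    simp only [image_univ, mem_range, mem_Ioi]
    constructor
    · rintro ⟨t, rfl⟩
      positivity
    · intro hs
      refine ⟨log (s / (R / (2 * p))), ?_⟩
      rw [exp_log (by positivity)]
      field_simp
  rw [← hrange, integral_image_eq_integral_abs_deriv_smul MeasurableSet.univ
    (fun t _ => (hderiv t).hasDerivWithinAt) hinj.injOn, setIntegral_univ]
  refine integral_congr_ae (.of_forall fun t => ?_)
  have hpos : 0 < R / (2 * p) * exp t := by positivity
  simp only [smul_eq_mul]
  rw [abs_of_pos hpos, mul_div_cancel₀ _ hpos.ne', ← exp_add, cosh_eq, exp_neg t]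
  congr 1
  field_simp
  ring

lemma integral_exp_div_eq_integral_cexp {p X : ℝ} (hp : 0 < p) (hX : 0 < X) (Y : ℝ) :
    ((∫ s in Ioi (0 : ℝ), exp (-s * p ^ 2) * exp (-(X ^ 2 + Y ^ 2) / (4 * s)) / s : ℝ) : ℂ) =
      ∫ t : ℝ, Complex.exp (-(p * ((X * cosh t : ℝ) + (Y * sinh t : ℝ) * Complex.I))) := by
  set w : ℂ := X + Y * Complex.I
  have hre : w.re = X := by simp [w]
  have him : w.im = Y := by simp [w]
  have hw : 0 < ‖w‖ := norm_pos_iff.mpr fun h => hX.ne' (by rw [← hre, h, Complex.zero_re])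
  have hsq : X ^ 2 + Y ^ 2 = ‖w‖ ^ 2 := by
    rw [Complex.sq_norm, Complex.normSq_apply, hre, him]
    ring
  have harg : |w.arg| < π / 2 := Complex.abs_arg_lt_pi_div_two_iff.mpr (.inl (hre ▸ hX))
  have hshift := integral_cexp_neg_mul_cosh_add_mul_I (mul_pos hp hw) harg
  rw [hsq, integral_exp_div_eq_integral_exp_neg_mul_cosh hp hw, ← integral_complex_ofReal]
  convert hshift.symm using 1
  · simp
  · refine integral_congr_ae (.of_forall fun t => ?_)
    simp only
    rw [cosh_ofReal_add_ofReal_mul_I, ← hre, ← him, ← Complex.norm_mul_cos_arg w,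
      ← Complex.norm_mul_sin_arg w]
    congr 1
    push_cast
    ring

lemma inv_sqrt_cosh_le (t : ℝ) : √(1 / cosh t) ≤ 8 * (1 + t ^ 2)⁻¹ := by
  have hhalf := one_add_sq_div_two_le_cosh (t / 2)
  have h : ((1 + t ^ 2) / 8) ^ 2 ≤ cosh t := by
    have h1 : (1 + t ^ 2) / 8 ≤ cosh (t / 2) := by nlinarith
    have h2 := cosh_two_mul (t / 2)
    rw [mul_div_cancel₀ t two_ne_zero] at h2
    have h3 : ((1 + t ^ 2) / 8) ^ 2 ≤ cosh (t / 2) ^ 2 := by gcongr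
    nlinarith [sq_nonneg (sinh (t / 2))]
  refine sqrt_le_iff.mpr ⟨by positivity, ?_⟩
  calc 1 / cosh t ≤ 1 / ((1 + t ^ 2) / 8) ^ 2 := by gcongr
    _ = _ := by field_simp

lemma integrable_cexp_neg_mul_cosh_add_cosh {p z z' : ℝ} (hp : 0 < p) (hz : 0 < z)
    (hzz' : z ≤ z') :
    Integrable (fun v : ℝ × ℝ => Complex.exp (-((p * z' : ℝ) * Complex.cosh v.1)) *
        Complex.exp (-((p * z : ℝ) * Complex.cosh (v.1 + v.2 * Complex.I))))
      (volume.prod (volume.restrict (Ioo (-π) π))) := by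
  have hnorm (t φ : ℝ) : ‖Complex.exp (-((p * z' : ℝ) * Complex.cosh t)) *
      Complex.exp (-((p * z : ℝ) * Complex.cosh (t + φ * Complex.I)))‖ =
      exp (-(p * cosh t * (z' + z * cos φ))) := by
    have h0 := norm_cexp_neg_mul_cosh (p * z') t 0
    rw [Complex.ofReal_zero, zero_mul, add_zero, cos_zero] at h0
    rw [norm_mul, h0, norm_cexp_neg_mul_cosh, ← exp_add]
    congr 1
    ring
  rw [integrable_prod_iff (Continuous.aestronglyMeasurable (by fun_prop))]
  refine ⟨.of_forall fun t => integrableOn_Ioo_neg_pi_pi (by fun_prop), ?_⟩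
  simp only [hnorm]
  refine (integrable_inv_one_add_sq.const_mul (16 * √(π ^ 3 / (2 * p * z)))).mono' ?_
    (.of_forall fun t => ?_)
  · refine AEStronglyMeasurable.integral_prod_right'
      (f := fun v : ℝ × ℝ => exp (-(p * cosh v.1 * (z' + z * cos v.2)))) ?_
    exact Continuous.aestronglyMeasurable (by fun_prop)
  · have hcosh := cosh_pos t
    rw [norm_of_nonneg (integral_nonneg fun φ => (exp_pos _).le)]
    calc ∫ φ in Ioo (-π) π, exp (-(p * cosh t * (z' + z * cos φ)))
        ≤ ∫ φ in Ioo (-π) π, exp (-(p * cosh t * z * (1 + cos φ))) := by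
          refine integral_mono (integrableOn_Ioo_neg_pi_pi (by fun_prop))
            (integrableOn_Ioo_neg_pi_pi (by fun_prop)) fun φ => ?_
          simp only
          rw [mul_assoc (p * cosh t)]
          gcongr
          linarith
      _ ≤ 2 * √(π / (2 * (p * cosh t * z) / π ^ 2)) :=
          integral_exp_neg_mul_one_add_cos_le (by positivity)
      _ = 2 * √(π ^ 3 / (2 * p * z)) * √(1 / cosh t) := by
          rw [mul_assoc 2, ← sqrt_mul (by positivity)]
          congr 2
          field_simp
      _ ≤ 2 * √(π ^ 3 / (2 * p * z)) * (8 * (1 + t ^ 2)⁻¹) := by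
          gcongr
          exact inv_sqrt_cosh_le t
      _ = 16 * √(π ^ 3 / (2 * p * z)) * (1 + t ^ 2)⁻¹ := by ring

/-- The average over `φ` of `K₀(p |z' + z e^{iφ}|)` is `I₀(pz) K₀(pz')`; here `K₀` appears as an
integral over the heat kernel. -/
lemma integral_integral_exp_div_eq_besselI0_mul_besselK0 {p z z' : ℝ} (hp : 0 < p) (hz : 0 < z)
    (hzz' : z ≤ z') :
    ∫ φ in Ioo (-π) π, ∫ s in Ioi (0 : ℝ),
        exp (-s * p ^ 2) * exp (-((z' + z * cos φ) ^ 2 + (z * sin φ) ^ 2) / (4 * s)) / s =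
      4 * π * (besselI0 (p * z) * besselK0 (p * z')) := by
  have hφ : ∀ φ ∈ Ioo (-π) π, ((∫ s in Ioi (0 : ℝ), exp (-s * p ^ 2) *
      exp (-((z' + z * cos φ) ^ 2 + (z * sin φ) ^ 2) / (4 * s)) / s : ℝ) : ℂ) =
      ∫ t : ℝ, Complex.exp (-((p * z' : ℝ) * Complex.cosh t)) *
        Complex.exp (-((p * z : ℝ) * Complex.cosh (t + φ * Complex.I))) := fun φ hφ => by
    have hcos : -1 < cos φ := by
      have h : 0 < cos (φ / 2) := cos_pos_of_mem_Ioo ⟨by linarith [hφ.1], by linarith [hφ.2]⟩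
      have h2 := cos_sq (φ / 2)
      rw [mul_div_cancel₀ φ two_ne_zero] at h2
      nlinarith
    rw [integral_exp_div_eq_integral_cexp hp (by nlinarith)]
    refine integral_congr_ae (.of_forall fun t => ?_)
    simp only
    rw [← Complex.exp_add, cosh_ofReal_add_ofReal_mul_I]
    congr 1
    push_cast
    ring
  have hK : ∫ t : ℝ, exp (-(p * z' * cosh t)) = 2 * besselK0 (p * z') := by
    rw [besselK0, ← integral_comp_abs (f := fun t => exp (-(p * z' * cosh t)))]
    simp_rw [cosh_abs]
  rw [← Complex.ofReal_inj, ← integral_complex_ofReal,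
    setIntegral_congr_fun measurableSet_Ioo hφ,
    ← integral_integral_swap (integrable_cexp_neg_mul_cosh_add_cosh hp hz hzz')]
  simp_rw [integral_const_mul, integral_Ioo_cexp_neg_mul_cosh]
  rw [integral_mul_const]
  have hcast (t : ℝ) : Complex.exp (-((p * z' : ℝ) * Complex.cosh t)) =
      (exp (-(p * z' * cosh t)) : ℝ) := by
    push_cast
    rfl
  simp_rw [hcast]
  rw [integral_complex_ofReal, hK]
  push_cast
  ring

/-- For `p > 0` and `0 < z ≤ z'`,
`∫₀^∞ k J₀(kz) J₀(kz')/(p² + k²) dk = I₀(pz) K₀(pz')`. -/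
theorem bessel_product_integral (p z z' : ℝ) (hp : 0 < p) (hz : 0 < z) (hzz' : z ≤ z') :
    IntegrableOn
      (fun k : ℝ => k * besselJ0 (k * z) * besselJ0 (k * z') / (p ^ 2 + k ^ 2))
      (Set.Ioi 0) ∧
    ∫ k in Set.Ioi (0:ℝ), k * besselJ0 (k * z) * besselJ0 (k * z') / (p ^ 2 + k ^ 2)
      = besselI0 (p * z) * besselK0 (p * z') := by
  have hG := integrable_heat_kernel_mul_besselJ0_mul_besselJ0 hp hz (hz.trans_le hzz')
  have hk (k : ℝ) : k * besselJ0 (k * z) * besselJ0 (k * z') / (p ^ 2 + k ^ 2) =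
      ∫ s in Ioi (0 : ℝ), exp (-s * p ^ 2) *
        (k * exp (-s * k ^ 2) * (besselJ0 (k * z) * besselJ0 (k * z'))) := by
    rw [integral_heat_kernel_mul hp, ← mul_assoc]
  simp_rw [hk]
  refine ⟨hG.integral_prod_right, ?_⟩
  set F : ℝ → ℝ → ℝ := fun s φ => 1 / (4 * π) *
    (exp (-s * p ^ 2) * exp (-((z' + z * cos φ) ^ 2 + (z * sin φ) ^ 2) / (4 * s)) / s)
  have hs : ∀ s ∈ Ioi (0 : ℝ), ∫ k in Ioi (0 : ℝ), exp (-s * p ^ 2) *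
      (k * exp (-s * k ^ 2) * (besselJ0 (k * z) * besselJ0 (k * z'))) =
      ∫ φ in Ioo (-π) π, F s φ := fun s hs => by
    rw [integral_const_mul, integral_mul_exp_neg_mul_sq_mul_besselJ0_mul_besselJ0 hs,
      ← integral_const_mul, ← integral_const_mul]
    refine integral_congr_ae (.of_forall fun φ => ?_)
    simp only [F]
    have hs' : s ≠ 0 := ne_of_gt hs
    field_simp
  have hF : Integrable (Function.uncurry F)
      ((volume.restrict (Ioi 0)).prod (volume.restrict (Ioo (-π) π))) := by
    rw [integrable_prod_iff (Measurable.aestronglyMeasurable (by fun_prop))]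
    refine ⟨.of_forall fun s => integrableOn_Ioo_neg_pi_pi
      (by simp only [F, Function.uncurry_apply_pair]; fun_prop), ?_⟩
    refine hG.integral_prod_left.congr
      ((ae_restrict_iff' measurableSet_Ioi).mpr (.of_forall fun s h => ?_))
    simp only
    rw [hs s h]
    refine integral_congr_ae (.of_forall fun φ => (norm_of_nonneg ?_).symm)
    have : 0 < s := h
    positivity
  rw [← integral_integral_swap hG, setIntegral_congr_fun measurableSet_Ioi hs,
    integral_integral_swap hF]
  simp_rw [F, integral_const_mul]
  rw [integral_integral_exp_div_eq_besselI0_mul_besselK0 hp hz hzz']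
  field_simp
end

section
/- Let s₁(z) = π²/(6z²) + 2ζ(3)/z and let ψ' denote the trigamma function. Then the integral J₆ = ∫₀¹ [ψ'(z)·ψ'(1−z) − s₁(z) − s₁(1−z)] dz converges and equals π²/3 − 2ζ(3) − 4ζ'(3), where ζ' is the derivative of the Riemann zeta function. -/
open MeasureTheory Real

/-- The trigamma function `ψ'(z) = Σ_{n≥0} 1/(z+n)²`. -/
noncomputable def trigamma (z : ℝ) : ℝ := ∑' n : ℕ, 1 / (z + (n : ℝ)) ^ 2

/-- `ζ(3) = Σ_{n≥1} 1/n³`. -/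
noncomputable def zeta3 : ℝ := ∑' n : ℕ, 1 / ((n : ℝ) + 1) ^ 3

/-- `ζ'(3)`, the derivative of the Riemann zeta function at `3`. -/
noncomputable def zetaPrime3 : ℝ := (deriv riemannZeta 3).re

/-- The subtraction term `s₁(z) = π²/(6z²) + 2ζ(3)/z`. -/
noncomputable def s1 (z : ℝ) : ℝ := Real.pi ^ 2 / (6 * z ^ 2) + 2 * zeta3 / z

/-- The part of the partial fraction decomposition of `1 / ((z + m)² (k + 1 - z)²)` with poles
at `z = -m`. -/
noncomputable def trigammaKernel (m k : ℕ) (z : ℝ) : ℝ :=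
  1 / ((m + k + 1 : ℝ) ^ 2 * (z + m) ^ 2) + 2 / ((m + k + 1 : ℝ) ^ 3 * (z + m))

lemma summable_one_div_nat_add_one_pow {p : ℕ} (hp : 1 < p) :
    Summable fun n : ℕ => 1 / ((n : ℝ) + 1) ^ p := by
  have h := (summable_nat_add_iff 1).2 (Real.summable_one_div_nat_pow.2 hp)
  simpa using h

lemma hasSum_one_div_nat_add_one_sq :
    HasSum (fun n : ℕ => 1 / ((n : ℝ) + 1) ^ 2) (Real.pi ^ 2 / 6) := by
  have h := (hasSum_nat_add_iff' 1).2 hasSum_zeta_two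
  simpa using h

lemma summable_one_div_add_nat_sq {z : ℝ} (hz : 0 < z) :
    Summable fun n : ℕ => 1 / (z + (n : ℝ)) ^ 2 := by
  rw [← summable_nat_add_iff 1]
  refine (summable_one_div_nat_add_one_pow one_lt_two).of_nonneg_of_le
    (fun n => by positivity) fun n => ?_
  push_cast
  have h : (n : ℝ) + 1 ≤ z + (n + 1) := le_add_of_nonneg_left hz.le
  gcongr

lemma trigammaKernel_nonneg (m k : ℕ) {z : ℝ} (hz : 0 ≤ z) : 0 ≤ trigammaKernel m k z := by
  unfold trigammaKernel
  positivity

lemma trigammaKernel_add_swap (m k : ℕ) {z : ℝ} (hz : 0 < z) (hz' : z < 1) :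
    trigammaKernel m k z + trigammaKernel k m (1 - z) =
      1 / (z + (m : ℝ)) ^ 2 * (1 / (1 - z + (k : ℝ)) ^ 2) := by
  have h1 : z + (m : ℝ) ≠ 0 := by positivity
  have h2 : 1 - z + (k : ℝ) ≠ 0 := by
    have : 0 < 1 - z := by linarith
    positivity
  have h3 : (m + k + 1 : ℝ) = (z + m) + (1 - z + k) := by ring
  have h4 : (k + m + 1 : ℝ) = (z + m) + (1 - z + k) := by ring
  have h5 : (z + m) + (1 - z + k) ≠ 0 := by rw [← h3]; positivity
  unfold trigammaKernel
  rw [h3, h4]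
  generalize z + (m : ℝ) = a at *
  generalize 1 - z + (k : ℝ) = b at *
  field_simp
  ring

lemma hasSum_trigammaKernel_add_swap {z : ℝ} (hz : 0 < z) (hz' : z < 1) :
    HasSum (fun p : ℕ × ℕ => trigammaKernel p.1 p.2 z + trigammaKernel p.2 p.1 (1 - z))
      (trigamma z * trigamma (1 - z)) := by
  have h1 := summable_norm_iff.2 (summable_one_div_add_nat_sq hz)
  have h2 := summable_norm_iff.2 (summable_one_div_add_nat_sq (sub_pos.2 hz'))
  simp only [trigammaKernel_add_swap _ _ hz hz', trigamma]
  rw [tsum_mul_tsum_of_summable_norm h1 h2]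
  exact (summable_mul_of_summable_norm h1 h2).hasSum

lemma summable_trigammaKernel {z : ℝ} (hz : 0 < z) (hz' : z < 1) :
    Summable fun p : ℕ × ℕ => trigammaKernel p.1 p.2 z :=
  (hasSum_trigammaKernel_add_swap hz hz').summable.of_nonneg_of_le
    (fun _ => trigammaKernel_nonneg _ _ hz.le)
    fun _ => le_add_of_nonneg_right (trigammaKernel_nonneg _ _ (sub_nonneg.2 hz'.le))

lemma hasSum_trigammaKernel_zero (z : ℝ) :
    HasSum (fun k : ℕ => trigammaKernel 0 k z) (s1 z) := by
  have h1 := hasSum_one_div_nat_add_one_sq.mul_right (1 / z ^ 2)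
  have h2 := (summable_one_div_nat_add_one_pow (p := 3) (by norm_num)).hasSum.mul_right (2 / z)
  convert! h1.add h2 using 1
  · funext k
    simp only [trigammaKernel, Nat.cast_zero, zero_add, add_zero, div_mul_div_comm, one_mul]
  · rw [s1, ← zeta3]
    ring

/-- The part of the double series of `trigammaKernel` that is regular on `[0, 1]`. -/
noncomputable def trigammaRegular (z : ℝ) : ℝ :=
  ∑' p : ℕ × ℕ, trigammaKernel (p.1 + 1) p.2 z

lemma tsum_trigammaKernel {z : ℝ} (hz : 0 < z) (hz' : z < 1) :
    ∑' p : ℕ × ℕ, trigammaKernel p.1 p.2 z = s1 z + trigammaRegular z := by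
  have h := summable_trigammaKernel hz hz'
  have h' : Summable fun p : ℕ × ℕ => trigammaKernel (p.1 + 1) p.2 z :=
    h.comp_injective (i := fun p : ℕ × ℕ => (p.1 + 1, p.2)) fun p q hpq => by
      simpa [Prod.ext_iff] using hpq
  rw [trigammaRegular, h.tsum_prod, h'.tsum_prod, h.prod.tsum_eq_zero_add,
    (hasSum_trigammaKernel_zero z).tsum_eq]

lemma trigamma_mul_sub_eq {z : ℝ} (hz : 0 < z) (hz' : z < 1) :
    trigamma z * trigamma (1 - z) - s1 z - s1 (1 - z) =
      trigammaRegular z + trigammaRegular (1 - z) := by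
  have hw : 0 < 1 - z := sub_pos.2 hz'
  have hw' : 1 - z < 1 := by linarith
  have h2 := (Equiv.prodComm ℕ ℕ).summable_iff.2 (summable_trigammaKernel hw hw')
  have e2 := (Equiv.prodComm ℕ ℕ).tsum_eq fun p : ℕ × ℕ => trigammaKernel p.1 p.2 (1 - z)
  have h := (summable_trigammaKernel hz hz').tsum_add h2
  simp only [Function.comp_apply, Equiv.prodComm_apply, Prod.fst_swap, Prod.snd_swap] at h e2
  rw [(hasSum_trigammaKernel_add_swap hz hz').tsum_eq, e2, tsum_trigammaKernel hz hz',
    tsum_trigammaKernel hw hw'] at h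
  rw [h]
  ring

lemma trigammaKernel_succ_le (m k : ℕ) {z : ℝ} (hz : 0 ≤ z) :
    trigammaKernel (m + 1) k z ≤ 3 * (1 / ((m : ℝ) + 1) ^ 2 * (1 / ((k : ℝ) + 1) ^ 2)) := by
  unfold trigammaKernel
  push_cast
  have hm : (0 : ℝ) ≤ m := m.cast_nonneg
  have hk : (0 : ℝ) ≤ k := k.cast_nonneg
  have hzm : (m : ℝ) + 1 ≤ z + (m + 1) := le_add_of_nonneg_left hz
  have hNk : (k : ℝ) + 1 ≤ m + 1 + k + 1 := by linarith
  have hNm : (m : ℝ) + 1 ≤ m + 1 + k + 1 := by linarith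
  have h1 : 1 / ((m + 1 + k + 1 : ℝ) ^ 2 * (z + (m + 1)) ^ 2) ≤
      1 / (((k : ℝ) + 1) ^ 2 * ((m : ℝ) + 1) ^ 2) := by
    gcongr
  have h2 : 2 / ((m + 1 + k + 1 : ℝ) ^ 3 * (z + (m + 1))) ≤
      2 / ((((k : ℝ) + 1) ^ 2 * ((m : ℝ) + 1)) * ((m : ℝ) + 1)) := by
    rw [pow_succ]
    gcongr
  refine (add_le_add h1 h2).trans (le_of_eq ?_)
  field_simp
  norm_num

lemma summable_trigammaKernel_bound :
    Summable fun p : ℕ × ℕ => 3 * (1 / ((p.1 : ℝ) + 1) ^ 2 * (1 / ((p.2 : ℝ) + 1) ^ 2)) := by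
  have h := summable_norm_iff.2 (summable_one_div_nat_add_one_pow one_lt_two)
  exact (summable_mul_of_summable_norm h h).mul_left 3

lemma continuousOn_trigammaKernel_succ (m k : ℕ) :
    ContinuousOn (trigammaKernel (m + 1) k) (Set.Icc 0 1) := by
  have h (z : ℝ) (hz : z ∈ Set.Icc (0 : ℝ) 1) : 0 < z + ((m + 1 : ℕ) : ℝ) :=
    add_pos_of_nonneg_of_pos hz.1 (by positivity)
  unfold trigammaKernel
  refine ContinuousOn.add (continuousOn_const.div (by fun_prop) fun z hz => ?_)
    (continuousOn_const.div (by fun_prop) fun z hz => ?_)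
  all_goals
    have := h z hz
    positivity

lemma norm_trigammaKernel_succ_le (p : ℕ × ℕ) {z : ℝ} (hz : 0 ≤ z) :
    ‖trigammaKernel (p.1 + 1) p.2 z‖ ≤
      3 * (1 / ((p.1 : ℝ) + 1) ^ 2 * (1 / ((p.2 : ℝ) + 1) ^ 2)) := by
  rw [Real.norm_of_nonneg (trigammaKernel_nonneg _ _ hz)]
  exact trigammaKernel_succ_le _ _ hz

lemma continuousOn_trigammaRegular : ContinuousOn trigammaRegular (Set.Icc 0 1) :=
  continuousOn_tsum (fun p => continuousOn_trigammaKernel_succ p.1 p.2)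
    summable_trigammaKernel_bound fun p _ hz => norm_trigammaKernel_succ_le p hz.1

lemma integral_trigammaKernel_succ (m k : ℕ) :
    ∫ z in (0 : ℝ)..1, trigammaKernel (m + 1) k z =
      1 / (m + k + 2 : ℝ) ^ 2 * (1 / ((m : ℝ) + 1) - 1 / ((m : ℝ) + 2)) +
        2 / (m + k + 2 : ℝ) ^ 3 * (Real.log ((m : ℝ) + 2) - Real.log ((m : ℝ) + 1)) := by
  have hc : ContinuousOn (trigammaKernel (m + 1) k) (Set.uIcc 0 1) := by
    rw [Set.uIcc_of_le zero_le_one]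
    exact continuousOn_trigammaKernel_succ m k
  rw [intervalIntegral.integral_eq_sub_of_hasDerivAt (f := fun z : ℝ =>
    1 / (m + k + 2 : ℝ) ^ 2 * (-(z + (m + 1))⁻¹) +
      2 / (m + k + 2 : ℝ) ^ 3 * Real.log (z + (m + 1))) ?_ hc.intervalIntegrable]
  · rw [show (1 : ℝ) + (m + 1) = m + 2 by ring, zero_add]
    ring
  · intro z hz
    rw [Set.uIcc_of_le zero_le_one] at hz
    have h : z + ((m : ℝ) + 1) ≠ 0 := (add_pos_of_nonneg_of_pos hz.1 (by positivity)).ne'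
    have hd := (hasDerivAt_id z).add_const ((m : ℝ) + 1)
    refine (((hd.inv h).neg.const_mul (1 / (m + k + 2 : ℝ) ^ 2)).add
      ((hd.log h).const_mul (2 / (m + k + 2 : ℝ) ^ 3))).congr_deriv ?_
    have hN : (m + k + 2 : ℝ) ≠ 0 := by positivity
    unfold trigammaKernel
    push_cast
    rw [show (m + 1 + k + 1 : ℝ) = m + k + 2 by ring]
    simp only [id]
    field_simp

lemma hasSum_integral_trigammaKernel_succ :
    HasSum (fun p : ℕ × ℕ => ∫ z in (0 : ℝ)..1, trigammaKernel (p.1 + 1) p.2 z)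
      (∫ z in (0 : ℝ)..1, trigammaRegular z) := by
  refine intervalIntegral.hasSum_integral_of_dominated_convergence
    (fun p _ => 3 * (1 / ((p.1 : ℝ) + 1) ^ 2 * (1 / ((p.2 : ℝ) + 1) ^ 2))) (fun p => ?_)
    (fun p => ?_) ?_ ?_ ?_
  · rw [Set.uIoc_of_le zero_le_one]
    exact ((continuousOn_trigammaKernel_succ p.1 p.2).mono
      Set.Ioc_subset_Icc_self).aestronglyMeasurable measurableSet_Ioc
  · refine Filter.Eventually.of_forall fun z hz => ?_
    rw [Set.uIoc_of_le zero_le_one] at hz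
    exact norm_trigammaKernel_succ_le p hz.1.le
  · exact Filter.Eventually.of_forall fun z _ => summable_trigammaKernel_bound
  · exact intervalIntegrable_const
  · refine Filter.Eventually.of_forall fun z hz => ?_
    rw [Set.uIoc_of_le zero_le_one] at hz
    exact (summable_trigammaKernel_bound.of_norm_bounded
      fun p => norm_trigammaKernel_succ_le p hz.1.le).hasSum

lemma sum_antidiagonal_integral_trigammaKernel_succ (n : ℕ) :
    ∑ p ∈ Finset.HasAntidiagonal.antidiagonal n, ∫ z in (0 : ℝ)..1, trigammaKernel (p.1 + 1) p.2 z =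
      1 / ((n : ℝ) + 2) ^ 2 - 1 / ((n : ℝ) + 2) ^ 3 +
        2 * (Real.log ((n : ℝ) + 2) / ((n : ℝ) + 2) ^ 3) := by
  have h : ∀ p ∈ Finset.HasAntidiagonal.antidiagonal n, ∫ z in (0 : ℝ)..1, trigammaKernel (p.1 + 1) p.2 z =
      1 / ((n : ℝ) + 2) ^ 2 * (1 / ((p.1 : ℝ) + 1) - 1 / ((p.1 : ℝ) + 2)) +
        2 / ((n : ℝ) + 2) ^ 3 * (Real.log ((p.1 : ℝ) + 2) - Real.log ((p.1 : ℝ) + 1)) := by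
    intro p hp
    rw [integral_trigammaKernel_succ, ← Finset.HasAntidiagonal.mem_antidiagonal.1 hp]
    push_cast
    rfl
  rw [Finset.sum_congr rfl h, Finset.Nat.sum_antidiagonal_eq_sum_range_succ_mk,
    Finset.sum_add_distrib, ← Finset.mul_sum, ← Finset.mul_sum]
  have h1 := Finset.sum_range_sub' (fun i : ℕ => 1 / ((i : ℝ) + 1)) (n + 1)
  have h2 := Finset.sum_range_sub (fun i : ℕ => Real.log ((i : ℝ) + 1)) (n + 1)
  push_cast at h1 h2
  simp only [add_assoc, one_add_one_eq_two, zero_add, Real.log_one, sub_zero, div_one] at h1 h2 ⊢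
  rw [h1, h2]
  have : (n : ℝ) + 2 ≠ 0 := by positivity
  field_simp

lemma hasSum_log_div_cube :
    HasSum (fun n : ℕ => Real.log ((n : ℝ) + 1) / ((n : ℝ) + 1) ^ 3) (-zetaPrime3) := by
  have habs : LSeries.abscissaOfAbsConv 1 < ((3 : ℂ).re : EReal) := by
    rw [LSeries.abscissaOfAbsConv_one]
    norm_num
    exact_mod_cast (by norm_num : (1 : ℝ) < 3)
  have hderiv : deriv riemannZeta 3 = -LSeries (LSeries.logMul 1) 3 := by
    rw [← LSeries_deriv habs]
    refine Filter.EventuallyEq.deriv_eq ?_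
    filter_upwards [(isOpen_lt continuous_const Complex.continuous_re).mem_nhds
      (show (1 : ℝ) < (3 : ℂ).re by norm_num)] with s hs
    exact (LSeries_one_eq_riemannZeta hs).symm
  have h := Complex.hasSum_re (LSeriesSummable_logMul_of_lt_re habs).LSeriesHasSum
  have h' := (hasSum_nat_add_iff' 1).2 h
  convert! h' using 1
  · funext n
    rw [LSeries.term_of_ne_zero n.succ_ne_zero]
    simp only [LSeries.logMul, Pi.one_apply, mul_one]
    rw [← Complex.natCast_log]
    norm_cast
  · simp [zetaPrime3, hderiv]

lemma integral_trigammaRegular :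
    ∫ z in (0 : ℝ)..1, trigammaRegular z =
      Real.pi ^ 2 / 6 - zeta3 - 2 * zetaPrime3 := by
  have h := (Finset.HasAntidiagonal.sigmaAntidiagonalEquivProd (A := ℕ)).hasSum_iff.2
    hasSum_integral_trigammaKernel_succ
  have h1 := h.sigma fun n => hasSum_fintype _
  have h2 := (hasSum_one_div_nat_add_one_sq.sub
    (summable_one_div_nat_add_one_pow (p := 3) (by norm_num)).hasSum).add
      (hasSum_log_div_cube.mul_left 2)
  have h3 := (hasSum_nat_add_iff' 1).2 h2
  have h4 : HasSum (fun n : ℕ => ∑ p ∈ Finset.HasAntidiagonal.antidiagonal n,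
      ∫ z in (0 : ℝ)..1, trigammaKernel (p.1 + 1) p.2 z) (∫ z in (0 : ℝ)..1, trigammaRegular z) := by
    convert h1 using 2 with n
    exact (Finset.sum_coe_sort (Finset.HasAntidiagonal.antidiagonal n) _).symm
  refine h4.unique ?_
  convert! h3 using 1
  · funext n
    rw [sum_antidiagonal_integral_trigammaKernel_succ]
    push_cast
    simp only [add_assoc, one_add_one_eq_two]
  · rw [← zeta3]
    simp
    ring

/-- `J₆ = ∫₀¹ [ψ'(z)ψ'(1−z) − s₁(z) − s₁(1−z)] dz` converges and equals
`π²/3 − 2ζ(3) − 4ζ'(3)`. -/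
theorem J6_value :
    IntegrableOn (fun z : ℝ => trigamma z * trigamma (1 - z) - s1 z - s1 (1 - z))
      (Set.Ioo 0 1) ∧
    ∫ z in Set.Ioo (0:ℝ) 1, (trigamma z * trigamma (1 - z) - s1 z - s1 (1 - z))
      = Real.pi ^ 2 / 3 - 2 * zeta3 - 4 * zetaPrime3 := by
  have heq : Set.EqOn (fun z : ℝ => trigamma z * trigamma (1 - z) - s1 z - s1 (1 - z))
      (fun z => trigammaRegular z + trigammaRegular (1 - z)) (Set.Ioo 0 1) :=
    fun z hz => trigamma_mul_sub_eq hz.1 hz.2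
  have h1 : IntervalIntegrable trigammaRegular volume 0 1 := by
    refine ContinuousOn.intervalIntegrable ?_
    rw [Set.uIcc_of_le zero_le_one]
    exact continuousOn_trigammaRegular
  have h2 : IntervalIntegrable (fun z => trigammaRegular (1 - z)) volume 0 1 := by
    simpa using (h1.comp_sub_left 1).symm
  constructor
  · rw [integrableOn_congr_fun heq measurableSet_Ioo, ← intervalIntegrable_iff_integrableOn_Ioo_of_le
      zero_le_one]
    exact h1.add h2
  · rw [setIntegral_congr_fun measurableSet_Ioo heq, ← integral_Ioc_eq_integral_Ioo,
      ← intervalIntegral.integral_of_le zero_le_one, intervalIntegral.integral_add h1 h2,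
      intervalIntegral.integral_comp_sub_left, sub_self, sub_zero, integral_trigammaRegular]
    ring
end

section
/- For every z > 0, the integral ∫₀^∞ [ 1/(2√ω) − z·I₀(√ω·z)·K₀(√ω·z) ] dω converges and equals 0. -/
open MeasureTheory Real

lemma Complex.det_restrictScalars_toSpanSingleton (c : ℂ) :
    ((ContinuousLinearMap.toSpanSingleton ℂ c).restrictScalars ℝ).det = Complex.normSq c := by
  rw [ContinuousLinearMap.det]
  have h : (((ContinuousLinearMap.toSpanSingleton ℂ c).restrictScalars ℝ : ℂ →L[ℝ] ℂ) : ℂ →ₗ[ℝ] ℂ)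
      = ((ContinuousLinearMap.toSpanSingleton ℂ c : ℂ →L[ℂ] ℂ) : ℂ →ₗ[ℂ] ℂ).restrictScalars ℝ := rfl
  rw [h, LinearMap.det_restrictScalars, LinearMap.det_ring]
  simp [Algebra.norm_complex_apply]

lemma Complex.cos_im (z : ℂ) : (Complex.cos z).im = -(Real.sin z.re * Real.sinh z.im) := by
  rw [Complex.cos_eq]
  simp [← Complex.ofReal_cos, ← Complex.ofReal_sin, ← Complex.ofReal_cosh, ← Complex.ofReal_sinh]

lemma Complex.cos_re (z : ℂ) : (Complex.cos z).re = Real.cos z.re * Real.cosh z.im := by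
  rw [Complex.cos_eq]
  simp [← Complex.ofReal_cos, ← Complex.ofReal_sin, ← Complex.ofReal_cosh, ← Complex.ofReal_sinh]

lemma Complex.norm_one_sub_cos (z : ℂ) :
    ‖1 - Complex.cos z‖ = Real.cosh z.im - Real.cos z.re := by
  have h0 : 0 ≤ Real.cosh z.im - Real.cos z.re := by
    linarith [Real.one_le_cosh z.im, Real.cos_le_one z.re]
  rw [← Real.sqrt_sq h0, Complex.norm_def, Complex.normSq_apply]
  congr 1
  simp only [Complex.sub_re, Complex.sub_im, Complex.one_re, Complex.one_im, Complex.cos_re,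
    Complex.cos_im]
  linear_combination (Real.sinh z.im) ^ 2 * Real.sin_sq_add_cos_sq z.re
    + (Real.cos z.re ^ 2 - 1) * Real.cosh_sq_sub_sinh_sq z.im

/-- The open half strip `(0, π) + i (0, ∞)`. -/
def halfStrip : Set ℂ := Set.Ioo 0 Real.pi ×ℂ Set.Ioi 0

lemma injOn_cos_halfStrip : Set.InjOn Complex.cos halfStrip := by
  intro z hz w hw h
  rw [halfStrip, Complex.mem_reProdIm] at hz hw
  simp only [Set.mem_Ioo, Set.mem_Ioi] at hz hw
  obtain ⟨k, hk | hk⟩ := Complex.cos_eq_cos_iff.1 h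
  · have hre := congrArg Complex.re hk
    simp at hre
    have hp := Real.pi_pos
    have h1 : (k : ℝ) < 1 := by nlinarith [hz.1.1, hz.1.2, hw.1.1, hw.1.2]
    have h2 : (-1 : ℝ) < k := by nlinarith [hz.1.1, hz.1.2, hw.1.1, hw.1.2]
    have h3 : k < 1 := by exact_mod_cast h1
    have h4 : -1 < k := by exact_mod_cast h2
    obtain rfl : k = 0 := by omega
    simpa using hk.symm
  · have him := congrArg Complex.im hk
    simp at him
    linarith [hz.2, hw.2]

lemma image_cos_halfStrip : Complex.cos '' halfStrip = {w : ℂ | w.im < 0} := by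
  ext w
  simp only [Set.mem_image, Set.mem_ofPred_eq, halfStrip, Complex.mem_reProdIm, Set.mem_Ioo,
    Set.mem_Ioi]
  constructor
  · rintro ⟨z, ⟨⟨h1, h2⟩, h3⟩, rfl⟩
    rw [Complex.cos_im]
    have := mul_pos (Real.sin_pos_of_pos_of_lt_pi h1 h2) (Real.sinh_pos_iff.2 h3)
    linarith
  · intro hw
    obtain ⟨z, rfl⟩ := Complex.cos_surjective w
    obtain ⟨k, hk, -⟩ := existsUnique_add_zsmul_mem_Ioc Real.two_pi_pos z.re (-Real.pi)
    have hcos : Complex.cos (z + k * (2 * Real.pi)) = Complex.cos z :=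
      Complex.cos_add_int_mul_two_pi z k
    rw [← hcos, Complex.cos_im] at hw
    rw [← hcos]
    set u := z + k * (2 * Real.pi) with hu
    have hre : u.re = z.re + k • (2 * Real.pi) := by simp [hu]
    rw [← hre] at hk
    have hk2 : u.re ≤ Real.pi := by linarith [hk.2]
    have hpos : 0 < Real.sin u.re * Real.sinh u.im := by linarith
    have key : ∀ s : ℂ, s.re ≤ Real.pi → 0 < Real.sin s.re → 0 < s.im → -Real.pi ≤ s.re →
        (0 < s.re ∧ s.re < Real.pi) ∧ 0 < s.im := by
      intro s h1 h2 h3 h4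
      refine ⟨⟨?_, ?_⟩, h3⟩
      · by_contra! h
        linarith [Real.sin_nonpos_of_nonpos_of_neg_pi_le h h4]
      · refine lt_of_le_of_ne h1 fun h => ?_
        rw [h, Real.sin_pi] at h2
        exact lt_irrefl _ h2
    rcases pos_and_pos_or_neg_and_neg_of_mul_pos hpos with ⟨h1, h2⟩ | ⟨h1, h2⟩
    · exact ⟨u, key u hk2 h1 (Real.sinh_pos_iff.1 h2) hk.1.le, rfl⟩
    · refine ⟨-u, key (-u) ?_ ?_ ?_ ?_, Complex.cos_neg u⟩
      · simpa using (by linarith [hk.1] : -u.re ≤ Real.pi)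
      · simpa using h1
      · simpa using Real.sinh_neg_iff.1 h2
      · simpa using hk2

lemma measurableSet_halfStrip : MeasurableSet halfStrip :=
  (measurableSet_Ioo.preimage Complex.measurable_re).inter
    (measurableSet_Ioi.preimage Complex.measurable_im)

lemma lintegral_halfStrip_eq_lintegral_lowerHalfPlane (x : ℝ) :
    ∫⁻ z in halfStrip, ENNReal.ofReal (Real.exp (-(x * (Real.cosh z.im - Real.cos z.re))))
      = ∫⁻ w in {w : ℂ | w.im < 0},
          ENNReal.ofReal (Real.exp (-(x * ‖1 - w‖)) / (‖1 - w‖ * ‖1 + w‖)) := by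
  rw [← image_cos_halfStrip, lintegral_image_eq_lintegral_abs_det_fderiv_mul volume
    measurableSet_halfStrip
    (fun z _ => (((Complex.hasDerivAt_cos z).hasFDerivAt).restrictScalars ℝ).hasFDerivWithinAt)
    injOn_cos_halfStrip]
  refine setLIntegral_congr_fun measurableSet_halfStrip fun z hz => ?_
  rw [Complex.det_restrictScalars_toSpanSingleton, ← ENNReal.ofReal_mul (abs_nonneg _),
    Complex.norm_one_sub_cos]
  congr 1
  have hs : Complex.normSq (-Complex.sin z)
      = ‖1 - Complex.cos z‖ * ‖1 + Complex.cos z‖ := by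
    rw [← norm_mul, Complex.normSq_eq_norm_sq, norm_neg, ← norm_pow, Complex.sin_sq]
    ring_nf
  have hne : Complex.normSq (-Complex.sin z) ≠ 0 := by
    have him : (Complex.cos z).im < 0 := by
      have : Complex.cos z ∈ {w : ℂ | w.im < 0} := image_cos_halfStrip ▸ ⟨z, hz, rfl⟩
      exact this
    rw [hs]
    refine mul_ne_zero ?_ ?_ <;> refine norm_ne_zero_iff.2 fun h => ?_ <;>
      have := congrArg Complex.im h <;> simp at this <;> linarith
  rw [← Complex.norm_one_sub_cos, ← hs, abs_of_nonneg (Complex.normSq_nonneg _)]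
  field_simp

lemma setLIntegral_Ioo_comp_sub_left (f : ℝ → ENNReal) (a b c : ℝ) :
    ∫⁻ x in Set.Ioo a b, f (c - x) = ∫⁻ x in Set.Ioo (c - b) (c - a), f x := by
  rw [← Set.image_const_sub_Ioo, lintegral_image_eq_lintegral_abs_deriv_mul (f' := fun _ => -1)
    measurableSet_Ioo (fun x _ => by
      simpa using ((hasDerivAt_id x).const_sub c).hasDerivWithinAt) sub_right_injective.injOn]
  simp

/-- The integrand obtained by writing the lower half plane integral in polar coordinates about `-1`:
`exp (-x √(y² + (2 sin φ)²)) / √(y² + (2 sin φ)²)`. -/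
noncomputable def polarKernel (x φ y : ℝ) : ENNReal :=
  ENNReal.ofReal (Real.exp (-(x * √(y ^ 2 + (2 * Real.sin φ) ^ 2)))
    / √(y ^ 2 + (2 * Real.sin φ) ^ 2))

lemma measurable_polarKernel (x : ℝ) :
    Measurable fun p : ℝ × ℝ => polarKernel x p.2 (p.1 - 2 * Real.cos p.2) := by
  unfold polarKernel
  fun_prop

lemma polarKernel_neg_left (x φ y : ℝ) : polarKernel x (-φ) y = polarKernel x φ y := by
  simp [polarKernel]

lemma polarKernel_pi_sub (x φ y : ℝ) : polarKernel x (Real.pi - φ) y = polarKernel x φ y := by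
  simp [polarKernel]

lemma polarKernel_neg_right (x φ y : ℝ) : polarKernel x φ (-y) = polarKernel x φ y := by
  simp [polarKernel]

lemma norm_two_sub_polar (r φ : ℝ) :
    ‖(2 : ℂ) - r * (Real.cos φ + Real.sin φ * Complex.I)‖
      = √((r - 2 * Real.cos φ) ^ 2 + (2 * Real.sin φ) ^ 2) := by
  rw [Complex.norm_def, Complex.normSq_apply]
  congr 1
  simp [-Complex.ofReal_cos, -Complex.ofReal_sin]
  linear_combination (r ^ 2 - 4) * Real.sin_sq_add_cos_sq φ

lemma lintegral_lowerHalfPlane_eq_polar (x : ℝ) :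
    ∫⁻ w in {w : ℂ | w.im < 0},
        ENNReal.ofReal (Real.exp (-(x * ‖1 - w‖)) / (‖1 - w‖ * ‖1 + w‖))
      = ∫⁻ φ in Set.Ioo 0 Real.pi, ∫⁻ r in Set.Ioi (0 : ℝ),
          polarKernel x φ (r - 2 * Real.cos φ) := by
  have hm : MeasurableSet {w : ℂ | w.im < 0} := measurableSet_Iio.preimage Complex.measurable_im
  rw [← lintegral_indicator hm, ← lintegral_sub_right_eq_self _ (1 : ℂ),
    ← Complex.lintegral_comp_polarCoord_symm, polarCoord_target]
  have hpt : ∀ p ∈ Set.Ioi (0 : ℝ) ×ˢ Set.Ioo (-Real.pi) Real.pi,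
      ENNReal.ofReal p.1 • ({w : ℂ | w.im < 0}.indicator (fun w =>
        ENNReal.ofReal (Real.exp (-(x * ‖1 - w‖)) / (‖1 - w‖ * ‖1 + w‖)))
          (Complex.polarCoord.symm p - 1))
      = (Set.Ioi (0 : ℝ) ×ˢ Set.Ioo (-Real.pi) 0).indicator
          (fun p => polarKernel x p.2 (p.1 - 2 * Real.cos p.2)) p := by
    rintro ⟨r, φ⟩ ⟨hr, hφ⟩
    simp only [Set.mem_Ioi, Set.mem_Ioo] at hr hφ
    rw [Complex.polarCoord_symm_apply]
    by_cases h : φ < 0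
    · have him : (r * (Real.cos φ + Real.sin φ * Complex.I) - 1 : ℂ) ∈ {w : ℂ | w.im < 0} := by
        simp [-Complex.ofReal_cos, -Complex.ofReal_sin]
        exact mul_neg_of_pos_of_neg hr (Real.sin_neg_of_neg_of_neg_pi_lt h hφ.1)
      rw [Set.indicator_of_mem him, Set.indicator_of_mem (by simp [hr, hφ.1, h]), polarKernel,
        smul_eq_mul, ← ENNReal.ofReal_mul hr.le, ← norm_two_sub_polar]
      congr 1
      have h1 : ‖(1 : ℂ) + (r * (Real.cos φ + Real.sin φ * Complex.I) - 1)‖ = r := by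
        have := Complex.norm_polarCoord_symm (r, φ)
        rw [Complex.polarCoord_symm_apply] at this
        rw [add_sub_cancel, this, abs_of_pos hr]
      have h2 : (1 : ℂ) - (r * (Real.cos φ + Real.sin φ * Complex.I) - 1)
          = 2 - r * (Real.cos φ + Real.sin φ * Complex.I) := by ring
      rw [h1, h2]
      field_simp
    · have him : (r * (Real.cos φ + Real.sin φ * Complex.I) - 1 : ℂ) ∉ {w : ℂ | w.im < 0} := by
        simp [-Complex.ofReal_cos, -Complex.ofReal_sin]
        exact mul_nonneg hr.le (Real.sin_nonneg_of_nonneg_of_le_pi (not_lt.1 h) hφ.2.le)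
      rw [Set.indicator_of_notMem him, Set.indicator_of_notMem (by simp [h]), smul_zero]
  rw [setLIntegral_congr_fun (measurableSet_Ioi.prod measurableSet_Ioo) hpt,
    setLIntegral_indicator (measurableSet_Ioi.prod measurableSet_Ioo)]
  have hset : Set.Ioi (0 : ℝ) ×ˢ Set.Ioo (-Real.pi) 0 ∩ Set.Ioi (0 : ℝ) ×ˢ Set.Ioo (-Real.pi) Real.pi
      = Set.Ioi (0 : ℝ) ×ˢ Set.Ioo (-Real.pi) 0 := by
    refine Set.inter_eq_left.2 (Set.prod_mono le_rfl (Set.Ioo_subset_Ioo le_rfl Real.pi_pos.le))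
  rw [hset, Measure.volume_eq_prod, setLIntegral_prod_symm _ (measurable_polarKernel x).aemeasurable]
  have := setLIntegral_Ioo_comp_sub_left (fun φ => ∫⁻ r in Set.Ioi (0 : ℝ),
          polarKernel x φ (r - 2 * Real.cos φ)) (-Real.pi) 0 0
  simpa [polarKernel_neg_left] using this

/-- `∫_ℝ exp (-c √(1+y²)) / √(1+y²) dy`, which is `2 K₀(c)`. -/
noncomputable def twoK0 (c : ℝ) : ENNReal :=
  ∫⁻ y : ℝ, ENNReal.ofReal (Real.exp (-(c * √(1 + y ^ 2))) / √(1 + y ^ 2))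

lemma lintegral_polarKernel (x : ℝ) {φ : ℝ} (hφ : 0 < Real.sin φ) :
    ∫⁻ y : ℝ, polarKernel x φ y = twoK0 (2 * x * Real.sin φ) := by
  set c := 2 * Real.sin φ with hc
  have hc0 : 0 < c := by positivity
  have himg : (fun y : ℝ => c * y) '' Set.univ = Set.univ :=
    Set.image_univ_of_surjective fun y => ⟨y / c, by field_simp⟩
  have h := lintegral_image_eq_lintegral_abs_deriv_mul (s := Set.univ) (f := fun y => c * y)
    (f' := fun _ => c) MeasurableSet.univ (fun y _ => (hasDerivAt_const_mul c).hasDerivWithinAt)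
    (mul_right_injective₀ hc0.ne').injOn (polarKernel x φ)
  rw [himg] at h
  simp only [setLIntegral_univ] at h
  rw [h, twoK0]
  refine lintegral_congr fun y => ?_
  rw [polarKernel, ← ENNReal.ofReal_mul (abs_nonneg _), abs_of_pos hc0]
  have hs : √((c * y) ^ 2 + c ^ 2) = c * √(1 + y ^ 2) := by
    rw [show (c * y) ^ 2 + c ^ 2 = c ^ 2 * (1 + y ^ 2) by ring, Real.sqrt_mul (sq_nonneg c),
      Real.sqrt_sq hc0.le]
  rw [← hc, hs, show 2 * x * Real.sin φ = x * c by rw [hc]; ring, mul_assoc x]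
  congr 1
  have : 0 < √(1 + y ^ 2) := by positivity
  field_simp

lemma lintegral_polarKernel_Ioi_add (x : ℝ) {φ : ℝ} (hφ : 0 < Real.sin φ) :
    (∫⁻ r in Set.Ioi (0 : ℝ), polarKernel x φ (r - 2 * Real.cos φ))
      + ∫⁻ r in Set.Ioi (0 : ℝ), polarKernel x (Real.pi - φ) (r - 2 * Real.cos (Real.pi - φ))
      = twoK0 (2 * x * Real.sin φ) := by
  have h2 : ∫⁻ r in Set.Ioi (0 : ℝ), polarKernel x (Real.pi - φ) (r - 2 * Real.cos (Real.pi - φ))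
      = ∫⁻ r in Set.Iio (0 : ℝ), polarKernel x φ (r - 2 * Real.cos φ) := by
    have himg : (fun y : ℝ => -y) '' Set.Ioi 0 = Set.Iio 0 := by simp
    rw [← himg, lintegral_image_eq_lintegral_abs_deriv_mul (f' := fun _ => -1)
      measurableSet_Ioi (fun x _ => (hasDerivAt_neg x).hasDerivWithinAt) neg_injective.injOn]
    refine lintegral_congr fun r => ?_
    rw [polarKernel_pi_sub, ← polarKernel_neg_right, Real.cos_pi_sub]
    simp only [abs_neg, abs_one, ENNReal.ofReal_one, one_mul]
    congr 1
    ring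
  rw [h2, add_comm, setLIntegral_congr (Ioi_ae_eq_Ici (a := (0 : ℝ))), ← Set.compl_Iio,
    lintegral_add_compl _ measurableSet_Iio, lintegral_sub_right_eq_self,
    lintegral_polarKernel x hφ]

lemma lintegral_polar_eq_lintegral_twoK0 (x : ℝ) :
    ∫⁻ φ in Set.Ioo 0 Real.pi, ∫⁻ r in Set.Ioi (0 : ℝ), polarKernel x φ (r - 2 * Real.cos φ)
      = ∫⁻ φ in Set.Ioo 0 (Real.pi / 2), twoK0 (2 * x * Real.sin φ) := by
  set H : ℝ → ENNReal := fun φ => ∫⁻ r in Set.Ioi (0 : ℝ),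
    polarKernel x φ (r - 2 * Real.cos φ) with hH
  have hHm : Measurable H := (measurable_polarKernel x).lintegral_prod_left'
  have hpi := Real.pi_pos
  have hsplit : Set.Ioo 0 Real.pi
      = Set.Ioo 0 (Real.pi / 2) ∪ Set.Ico (Real.pi / 2) Real.pi :=
    (Set.Ioo_union_Ico_eq_Ioo (by linarith) (by linarith)).symm
  have hdisj : Disjoint (Set.Ioo 0 (Real.pi / 2)) (Set.Ico (Real.pi / 2) Real.pi) :=
    Set.disjoint_left.2 fun a h1 h2 => not_le.2 h1.2 h2.1
  rw [hsplit, lintegral_union measurableSet_Ico hdisj,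
    setLIntegral_congr (Ioo_ae_eq_Ico (a := Real.pi / 2)).symm]
  have h := setLIntegral_Ioo_comp_sub_left H 0 (Real.pi / 2) Real.pi
  rw [sub_zero, sub_half] at h
  rw [← h, ← lintegral_add_left hHm]
  refine setLIntegral_congr_fun measurableSet_Ioo fun φ hφ => ?_
  exact lintegral_polarKernel_Ioi_add x
    (Real.sin_pos_of_pos_of_lt_pi hφ.1 (by linarith [hφ.2]))

lemma integrableOn_exp_neg_mul_cosh {x : ℝ} (hx : 0 < x) :
    IntegrableOn (fun t => Real.exp (-(x * Real.cosh t))) (Set.Ioi 0) := by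
  refine Integrable.mono' (integrableOn_exp_mul_Ioi (neg_lt_zero.2 hx) 0)
    (by fun_prop) ((ae_restrict_iff' measurableSet_Ioi).2 (ae_of_all _ fun t ht => ?_))
  have ht : (0 : ℝ) < t := ht
  rw [Real.norm_eq_abs, abs_of_pos (Real.exp_pos _), Real.exp_le_exp]
  nlinarith [Real.sinh_lt_cosh t, Real.self_le_sinh_iff.2 ht.le]

lemma pi_mul_besselI0 (x : ℝ) :
    Real.pi * besselI0 x = ∫ θ in Set.Ioo 0 Real.pi, Real.exp (x * Real.cos θ) := by
  have hi : ∀ c : ℝ, IntervalIntegrable (fun θ => Real.exp (c * Real.cos θ)) volume 0 Real.pi :=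
    fun c => (by fun_prop : Continuous fun θ => Real.exp (c * Real.cos θ)).intervalIntegrable _ _
  have hs : ∫ θ in (0 : ℝ)..Real.pi, Real.exp (-x * Real.cos θ)
      = ∫ θ in (0 : ℝ)..Real.pi, Real.exp (x * Real.cos θ) := by
    have := intervalIntegral.integral_comp_sub_left (a := 0) (b := Real.pi)
      (fun θ => Real.exp (x * Real.cos θ)) Real.pi
    simpa [Real.cos_pi_sub] using this
  have hc : ∀ θ : ℝ, Real.cosh (x * Real.cos θ)
      = (Real.exp (x * Real.cos θ) + Real.exp (-x * Real.cos θ)) / 2 := fun θ => by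
    rw [Real.cosh_eq, neg_mul]
  rw [← integral_Ioc_eq_integral_Ioo, ← intervalIntegral.integral_of_le Real.pi_pos.le, besselI0,
    ← mul_assoc, mul_one_div_cancel Real.pi_ne_zero, one_mul]
  simp_rw [hc]
  rw [intervalIntegral.integral_div, intervalIntegral.integral_add (hi x) (hi (-x)), hs]
  ring

lemma ofReal_pi_mul_besselI0_mul_besselK0 {x : ℝ} (hx : 0 < x) :
    ENNReal.ofReal (Real.pi * besselI0 x * besselK0 x)
      = ∫⁻ φ in Set.Ioo 0 (Real.pi / 2), twoK0 (2 * x * Real.sin φ) := by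
  rw [← lintegral_polar_eq_lintegral_twoK0, ← lintegral_lowerHalfPlane_eq_polar,
    ← lintegral_halfStrip_eq_lintegral_lowerHalfPlane]
  have h1 : ENNReal.ofReal (Real.pi * besselI0 x)
      = ∫⁻ θ in Set.Ioo 0 Real.pi, ENNReal.ofReal (Real.exp (x * Real.cos θ)) := by
    rw [pi_mul_besselI0, ofReal_integral_eq_lintegral_ofReal]
    · exact (((by fun_prop : Continuous fun θ => Real.exp (x * Real.cos θ)).integrableOn_Icc).mono_set
        Set.Ioo_subset_Icc_self)
    · exact ae_of_all _ fun θ => (Real.exp_pos _).le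
  have h2 : ENNReal.ofReal (besselK0 x)
      = ∫⁻ t in Set.Ioi (0 : ℝ), ENNReal.ofReal (Real.exp (-(x * Real.cosh t))) := by
    rw [besselK0, ofReal_integral_eq_lintegral_ofReal (integrableOn_exp_neg_mul_cosh hx)
      (ae_of_all _ fun θ => (Real.exp_pos _).le)]
  have hI : 0 ≤ Real.pi * besselI0 x := by
    rw [pi_mul_besselI0]
    exact integral_nonneg fun θ => (Real.exp_pos _).le
  rw [ENNReal.ofReal_mul hI, h1, h2, ← lintegral_prod_mul (by fun_prop) (by fun_prop),
    Measure.prod_restrict, ← Measure.volume_eq_prod]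
  have hpre : halfStrip
      = Complex.measurableEquivRealProd ⁻¹' (Set.Ioo 0 Real.pi ×ˢ Set.Ioi 0) := rfl
  rw [hpre, ← Complex.volume_preserving_equiv_real_prod.setLIntegral_comp_preimage_emb
    Complex.measurableEquivRealProd.measurableEmbedding]
  refine lintegral_congr fun z => ?_
  rw [← ENNReal.ofReal_mul (Real.exp_pos _).le, ← Real.exp_add]
  simp only [Complex.measurableEquivRealProd_apply]
  ring_nf

lemma measurable_twoK0 : Measurable twoK0 := by
  have : Measurable fun p : ℝ × ℝ =>
      ENNReal.ofReal (Real.exp (-(p.1 * √(1 + p.2 ^ 2))) / √(1 + p.2 ^ 2)) := by fun_prop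
  exact this.lintegral_prod_right'

lemma setLIntegral_Ioi_comp_mul_left (f : ℝ → ENNReal) {c : ℝ} (hc : 0 < c) :
    ∫⁻ v in Set.Ioi (0 : ℝ), f (c * v) = ENNReal.ofReal (1 / c) * ∫⁻ v in Set.Ioi (0 : ℝ), f v := by
  have himg : (fun y : ℝ => c * y) '' Set.Ioi 0 = Set.Ioi 0 := by
    simpa using Set.image_mul_left_Ioi hc 0
  have h := lintegral_image_eq_lintegral_abs_deriv_mul (f := fun y => c * y) (f' := fun _ => c)
    measurableSet_Ioi (fun y _ => (hasDerivAt_const_mul c).hasDerivWithinAt)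
    (mul_right_injective₀ hc.ne').injOn (s := Set.Ioi (0 : ℝ)) f
  rw [himg, lintegral_const_mul' _ _ ENNReal.ofReal_ne_top, abs_of_pos hc] at h
  rw [h, ← mul_assoc, ← ENNReal.ofReal_mul (by positivity), one_div_mul_cancel hc.ne',
    ENNReal.ofReal_one, one_mul]

lemma lintegral_Ioi_exp_neg_mul {q : ℝ} (hq : 0 < q) :
    ∫⁻ c in Set.Ioi (0 : ℝ), ENNReal.ofReal (Real.exp (-(c * q))) = ENNReal.ofReal (1 / q) := by
  have hq' : -q < 0 := neg_lt_zero.2 hq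
  have h : ∀ c : ℝ, -(c * q) = -q * c := fun c => by ring
  simp_rw [h]
  rw [← ofReal_integral_eq_lintegral_ofReal (integrableOn_exp_mul_Ioi hq' 0)
    (ae_of_all _ fun θ => (Real.exp_pos _).le), integral_exp_mul_Ioi hq']
  simp

lemma lintegral_Ioi_exp_neg_sqrt_mul {q : ℝ} (hq : 0 < q) :
    ∫⁻ w in Set.Ioi (0 : ℝ), ENNReal.ofReal (Real.exp (-(√w * q))) = ENNReal.ofReal (2 / q ^ 2) := by
  have hint := integral_exp_neg_mul_rpow (p := 1 / 2) (by norm_num) hq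
  have hG : Real.Gamma (1 / (1 / 2) + 1) = 2 := by
    norm_num
  have hval : q ^ (-1 / (1 / 2) : ℝ) = 1 / q ^ 2 := by
    rw [show (-1 / (1 / 2) : ℝ) = -(2 : ℕ) by norm_num, Real.rpow_neg hq.le, Real.rpow_natCast,
      one_div]
  rw [hG, hval] at hint
  have h : ∀ w : ℝ, -(√w * q) = -q * w ^ (1 / 2 : ℝ) := fun w => by
    rw [Real.sqrt_eq_rpow]
    ring
  simp_rw [h]
  rw [← ofReal_integral_eq_lintegral_ofReal _ (ae_of_all _ fun θ => (Real.exp_pos _).le), hint]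
  · congr 1
    ring
  · by_contra hn
    rw [integral_undef hn] at hint
    have : 0 < 1 / q ^ 2 * 2 := by positivity
    exact this.ne hint

lemma lintegral_Ioi_twoK0_comp {g : ℝ → ℝ} (hg : Measurable g) {F : ℝ → ℝ}
    (hF : ∀ q, 0 < q →
      ∫⁻ c in Set.Ioi (0 : ℝ), ENNReal.ofReal (Real.exp (-(g c * q))) = ENNReal.ofReal (F q)) :
    ∫⁻ c in Set.Ioi (0 : ℝ), twoK0 (g c)
      = ∫⁻ y : ℝ, ENNReal.ofReal (1 / √(1 + y ^ 2)) * ENNReal.ofReal (F √(1 + y ^ 2)) := by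
  unfold twoK0
  rw [lintegral_lintegral_swap (by fun_prop)]
  refine lintegral_congr fun y => ?_
  have hq : 0 < √(1 + y ^ 2) := by positivity
  rw [← hF _ hq, ← lintegral_const_mul' _ _ ENNReal.ofReal_ne_top]
  refine lintegral_congr fun c => ?_
  rw [← ENNReal.ofReal_mul (by positivity)]
  congr 1
  ring

lemma lintegral_inv_one_add_sq :
    ∫⁻ y : ℝ, ENNReal.ofReal (1 + y ^ 2)⁻¹ = ENNReal.ofReal Real.pi := by
  rw [← integral_univ_inv_one_add_sq, ofReal_integral_eq_lintegral_ofReal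
    integrable_inv_one_add_sq (ae_of_all _ fun y => by positivity)]

lemma lintegral_Ioi_twoK0 :
    ∫⁻ c in Set.Ioi (0 : ℝ), twoK0 c = ENNReal.ofReal Real.pi := by
  rw [lintegral_Ioi_twoK0_comp (g := fun c => c) measurable_id
    (F := fun q => 1 / q) (fun q hq => lintegral_Ioi_exp_neg_mul hq), ← lintegral_inv_one_add_sq]
  refine lintegral_congr fun y => ?_
  rw [← ENNReal.ofReal_mul (by positivity), one_div_mul_one_div,
    Real.mul_self_sqrt (by positivity), one_div]

lemma lintegral_Ioi_twoK0_sqrt_ne_top :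
    ∫⁻ w in Set.Ioi (0 : ℝ), twoK0 √w ≠ ⊤ := by
  rw [lintegral_Ioi_twoK0_comp (g := fun w => √w) (by fun_prop)
    (F := fun q => 2 / q ^ 2) (fun q hq => lintegral_Ioi_exp_neg_sqrt_mul hq)]
  refine ne_top_of_le_ne_top (b := ENNReal.ofReal 2 * ENNReal.ofReal Real.pi)
    (ENNReal.mul_ne_top ENNReal.ofReal_ne_top ENNReal.ofReal_ne_top) ?_
  rw [← lintegral_inv_one_add_sq, ← lintegral_const_mul' _ _ ENNReal.ofReal_ne_top]
  refine lintegral_mono fun y => ?_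
  rw [← ENNReal.ofReal_mul (by positivity), ← ENNReal.ofReal_mul (by positivity)]
  refine ENNReal.ofReal_le_ofReal ?_
  rw [Real.sq_sqrt (by positivity), div_eq_mul_inv 2]
  refine mul_le_of_le_one_left (by positivity) ?_
  rw [div_le_one (by positivity)]
  exact Real.one_le_sqrt.2 (by nlinarith [sq_nonneg y])

lemma lintegral_Ioi_twoK0_mul_sqrt {c : ℝ} (hc : 0 < c) :
    ∫⁻ w in Set.Ioi (0 : ℝ), twoK0 (c * √w)
      = ENNReal.ofReal (1 / c ^ 2) * ∫⁻ w in Set.Ioi (0 : ℝ), twoK0 √w := by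
  rw [← setLIntegral_Ioi_comp_mul_left _ (by positivity)]
  refine lintegral_congr fun w => ?_
  rw [Real.sqrt_mul (by positivity), Real.sqrt_sq hc.le]

lemma lintegral_Ioi_one_inv_sq :
    ∫⁻ v in Set.Ioi (1 : ℝ), ENNReal.ofReal (1 / v ^ 2) = 1 := by
  have h : ∀ v ∈ Set.Ioi (1 : ℝ), ENNReal.ofReal (1 / v ^ 2) = ENNReal.ofReal (v ^ (-2 : ℝ)) := by
    intro v hv
    have hv0 : (0 : ℝ) < v := lt_trans one_pos hv
    rw [Real.rpow_neg hv0.le, one_div]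
    norm_num
  rw [setLIntegral_congr_fun measurableSet_Ioi h, ← ofReal_integral_eq_lintegral_ofReal
    (integrableOn_Ioi_rpow_of_lt (by norm_num) one_pos)
    ((ae_restrict_iff' measurableSet_Ioi).2 (ae_of_all _ fun v hv =>
      Real.rpow_nonneg (lt_trans one_pos hv).le _)),
    integral_Ioi_rpow_of_lt (by norm_num) one_pos]
  norm_num

lemma lintegral_one_sub_cos_div_sin_sq :
    ∫⁻ φ in Set.Ioo 0 (Real.pi / 2), ENNReal.ofReal ((1 - Real.cos φ) / Real.sin φ ^ 2) = 1 := by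
  have hpi := Real.pi_pos
  have hcos : ∀ φ ∈ Set.Icc 0 (Real.pi / 2), 0 ≤ Real.cos φ := fun φ hφ =>
    Real.cos_nonneg_of_neg_pi_div_two_le_of_le (by linarith [hφ.1]) hφ.2
  have hcont : ContinuousOn (fun φ => 1 / (1 + Real.cos φ)) (Set.Icc 0 (Real.pi / 2)) :=
    continuousOn_const.div (by fun_prop) fun φ hφ => by linarith [hcos φ hφ]
  have h : ∀ φ ∈ Set.Ioo 0 (Real.pi / 2), ENNReal.ofReal ((1 - Real.cos φ) / Real.sin φ ^ 2)
      = ENNReal.ofReal (1 / (1 + Real.cos φ)) := by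
    intro φ hφ
    have hs := Real.sin_pos_of_pos_of_lt_pi hφ.1 (by linarith [hφ.2])
    have := hcos φ (Set.Ioo_subset_Icc_self hφ)
    congr 1
    rw [div_eq_div_iff (by positivity) (by positivity), Real.sin_sq]
    ring
  have hint : ∫ φ in (0 : ℝ)..Real.pi / 2, 1 / (1 + Real.cos φ) = 1 := by
    rw [intervalIntegral.integral_eq_sub_of_hasDerivAt
      (f := fun φ => Real.sin φ / (1 + Real.cos φ))]
    · simp
    · intro φ hφ
      rw [Set.uIcc_of_le (by positivity)] at hφ
      have hne : 1 + Real.cos φ ≠ 0 := by linarith [hcos φ hφ]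
      refine ((Real.hasDerivAt_sin φ).div ((Real.hasDerivAt_cos φ).const_add 1) hne).congr_deriv ?_
      field_simp
      linear_combination Real.sin_sq_add_cos_sq φ
    · exact (hcont.intervalIntegrable_of_Icc (by positivity))
  rw [setLIntegral_congr_fun measurableSet_Ioo h, ← ofReal_integral_eq_lintegral_ofReal
    (hcont.integrableOn_Icc.mono_set Set.Ioo_subset_Icc_self)
    ((ae_restrict_iff' measurableSet_Ioo).2 (ae_of_all _ fun φ hφ => by
      have := hcos φ (Set.Ioo_subset_Icc_self hφ)
      simp only [Pi.zero_apply]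
      positivity)),
    ← integral_Ioc_eq_integral_Ioo, ← intervalIntegral.integral_of_le (by positivity), hint,
    ENNReal.ofReal_one]

lemma lintegral_twoK0_mul_cos (a : ℝ) :
    ∫⁻ φ in Set.Ioo 0 (Real.pi / 2), twoK0 (a * Real.sin φ) * ENNReal.ofReal (Real.cos φ)
      = ∫⁻ v in Set.Ioo (0 : ℝ) 1, twoK0 (a * v) := by
  have hpi := Real.pi_pos
  have hinj : Set.InjOn Real.sin (Set.Ioo 0 (Real.pi / 2)) :=
    Real.injOn_sin.mono (Set.Ioo_subset_Icc_self.trans (Set.Icc_subset_Icc (by linarith) le_rfl))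
  have himg : Real.sin '' Set.Ioo 0 (Real.pi / 2) = Set.Ioo 0 1 := by
    ext v
    constructor
    · rintro ⟨φ, hφ, rfl⟩
      refine ⟨Real.sin_pos_of_pos_of_lt_pi hφ.1 (by linarith [hφ.2]), ?_⟩
      rw [← Real.sin_pi_div_two]
      exact Real.sin_lt_sin_of_lt_of_le_pi_div_two (by linarith [hφ.1]) le_rfl hφ.2
    · intro hv
      exact ⟨Real.arcsin v, ⟨Real.arcsin_pos.2 hv.1, Real.arcsin_lt_pi_div_two.2 hv.2⟩,
        Real.sin_arcsin (by linarith [hv.1]) hv.2.le⟩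
  rw [← himg, lintegral_image_eq_lintegral_abs_deriv_mul measurableSet_Ioo
    (fun φ _ => (Real.hasDerivAt_sin φ).hasDerivWithinAt) hinj]
  refine setLIntegral_congr_fun measurableSet_Ioo fun φ hφ => ?_
  rw [abs_of_nonneg (Real.cos_nonneg_of_neg_pi_div_two_le_of_le (by linarith [hφ.1]) hφ.2.le),
    mul_comm]

/-- The part of `1/2 - x I₀ K₀` that is subtracted, up to a constant factor. -/
noncomputable def negDefect (x : ℝ) : ENNReal :=
  ∫⁻ φ in Set.Ioo 0 (Real.pi / 2), twoK0 (2 * x * Real.sin φ) * ENNReal.ofReal (1 - Real.cos φ)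

/-- The part of `1/2 - x I₀ K₀` that is added, up to a constant factor. -/
noncomputable def posDefect (x : ℝ) : ENNReal :=
  ∫⁻ v in Set.Ioi (1 : ℝ), twoK0 (2 * x * v)

lemma besselI0_mul_besselK0_add_posDefect {x : ℝ} (hx : 0 < x) :
    ENNReal.ofReal (Real.pi * besselI0 x * besselK0 x) + posDefect x
      = negDefect x + ENNReal.ofReal (Real.pi / (2 * x)) := by
  have hpi := Real.pi_pos
  have htot : (∫⁻ v in Set.Ioo (0 : ℝ) 1, twoK0 (2 * x * v)) + posDefect x
      = ENNReal.ofReal (Real.pi / (2 * x)) := by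
    rw [posDefect, setLIntegral_congr (Ioi_ae_eq_Ici (a := (1 : ℝ))), ← lintegral_union
      measurableSet_Ici (Set.disjoint_left.2 fun a h1 h2 => not_le.2 h1.2 h2),
      Set.Ioo_union_Ici_eq_Ioi one_pos, setLIntegral_Ioi_comp_mul_left _ (by positivity),
      lintegral_Ioi_twoK0, ← ENNReal.ofReal_mul (by positivity)]
    congr 1
    ring
  have hsplit : ENNReal.ofReal (Real.pi * besselI0 x * besselK0 x)
      = negDefect x + ∫⁻ v in Set.Ioo (0 : ℝ) 1, twoK0 (2 * x * v) := by
    have hm : Measurable fun φ =>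
        twoK0 (2 * x * Real.sin φ) * ENNReal.ofReal (1 - Real.cos φ) :=
      (measurable_twoK0.comp (by fun_prop)).mul (by fun_prop)
    rw [ofReal_pi_mul_besselI0_mul_besselK0 hx, ← lintegral_twoK0_mul_cos, negDefect,
      ← lintegral_add_left hm]
    refine setLIntegral_congr_fun measurableSet_Ioo fun φ hφ => ?_
    rw [← mul_add, ← ENNReal.ofReal_add (by linarith [Real.cos_le_one φ])
      (Real.cos_nonneg_of_neg_pi_div_two_le_of_le (by linarith [hφ.1]) hφ.2.le)]
    simp
  rw [hsplit, add_assoc, htot]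

lemma posDefect_ne_top {x : ℝ} (hx : 0 < x) : posDefect x ≠ ⊤ := by
  refine ne_top_of_le_ne_top ?_ (lintegral_mono_set (Set.Ioi_subset_Ioi zero_le_one))
  rw [setLIntegral_Ioi_comp_mul_left _ (by positivity), lintegral_Ioi_twoK0]
  exact ENNReal.mul_ne_top ENNReal.ofReal_ne_top ENNReal.ofReal_ne_top

lemma negDefect_ne_top {x : ℝ} (hx : 0 < x) : negDefect x ≠ ⊤ := by
  have h : negDefect x + ENNReal.ofReal (Real.pi / (2 * x)) ≠ ⊤ := by
    rw [← besselI0_mul_besselK0_add_posDefect hx]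
    exact ENNReal.add_ne_top.2 ⟨ENNReal.ofReal_ne_top, posDefect_ne_top hx⟩
  exact (ENNReal.add_ne_top.1 h).1

lemma measurable_posDefect : Measurable posDefect := by
  have : Measurable fun p : ℝ × ℝ => twoK0 (2 * p.1 * p.2) :=
    measurable_twoK0.comp (by fun_prop)
  exact this.lintegral_prod_right'

lemma measurable_negDefect : Measurable negDefect := by
  have : Measurable fun p : ℝ × ℝ =>
      twoK0 (2 * p.1 * Real.sin p.2) * ENNReal.ofReal (1 - Real.cos p.2) :=
    (measurable_twoK0.comp (by fun_prop)).mul (by fun_prop)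
  exact this.lintegral_prod_right'

lemma lintegral_posDefect {z : ℝ} (hz : 0 < z) :
    ∫⁻ w in Set.Ioi (0 : ℝ), posDefect (√w * z)
      = ENNReal.ofReal (1 / (2 * z) ^ 2) * ∫⁻ w in Set.Ioi (0 : ℝ), twoK0 √w := by
  have hm : Measurable fun p : ℝ × ℝ => twoK0 (2 * (√p.1 * z) * p.2) :=
    measurable_twoK0.comp (by fun_prop)
  unfold posDefect
  rw [lintegral_lintegral_swap hm.aemeasurable]
  have h : ∀ v ∈ Set.Ioi (1 : ℝ), ∫⁻ w in Set.Ioi (0 : ℝ), twoK0 (2 * (√w * z) * v)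
      = (ENNReal.ofReal (1 / (2 * z) ^ 2) * ∫⁻ w in Set.Ioi (0 : ℝ), twoK0 √w)
        * ENNReal.ofReal (1 / v ^ 2) := by
    intro v hv
    have hv0 : (0 : ℝ) < v := lt_trans one_pos hv
    rw [mul_right_comm, ← ENNReal.ofReal_mul (by positivity), one_div_mul_one_div, ← mul_pow,
      ← lintegral_Ioi_twoK0_mul_sqrt (by positivity)]
    refine lintegral_congr fun w => congrArg twoK0 ?_
    ring
  rw [setLIntegral_congr_fun measurableSet_Ioi h, lintegral_const_mul' _ _
    (ENNReal.mul_ne_top ENNReal.ofReal_ne_top lintegral_Ioi_twoK0_sqrt_ne_top),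
    lintegral_Ioi_one_inv_sq, mul_one]

lemma lintegral_negDefect {z : ℝ} (hz : 0 < z) :
    ∫⁻ w in Set.Ioi (0 : ℝ), negDefect (√w * z)
      = ENNReal.ofReal (1 / (2 * z) ^ 2) * ∫⁻ w in Set.Ioi (0 : ℝ), twoK0 √w := by
  have hm : Measurable fun p : ℝ × ℝ =>
      twoK0 (2 * (√p.1 * z) * Real.sin p.2) * ENNReal.ofReal (1 - Real.cos p.2) :=
    (measurable_twoK0.comp (by fun_prop)).mul (by fun_prop)
  unfold negDefect
  rw [lintegral_lintegral_swap hm.aemeasurable]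
  have h : ∀ φ ∈ Set.Ioo 0 (Real.pi / 2), ∫⁻ w in Set.Ioi (0 : ℝ),
      twoK0 (2 * (√w * z) * Real.sin φ) * ENNReal.ofReal (1 - Real.cos φ)
      = (ENNReal.ofReal (1 / (2 * z) ^ 2) * ∫⁻ w in Set.Ioi (0 : ℝ), twoK0 √w)
        * ENNReal.ofReal ((1 - Real.cos φ) / Real.sin φ ^ 2) := by
    intro φ hφ
    have hs := Real.sin_pos_of_pos_of_lt_pi hφ.1 (by linarith [hφ.2, Real.pi_pos])
    rw [lintegral_mul_const' _ _ ENNReal.ofReal_ne_top, div_eq_mul_one_div (1 - Real.cos φ),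
      mul_comm (1 - Real.cos φ), ENNReal.ofReal_mul (by positivity), ← mul_assoc]
    congr 1
    rw [mul_right_comm, ← ENNReal.ofReal_mul (by positivity), one_div_mul_one_div, ← mul_pow,
      ← lintegral_Ioi_twoK0_mul_sqrt (by positivity)]
    refine lintegral_congr fun w => congrArg twoK0 ?_
    ring
  rw [setLIntegral_congr_fun measurableSet_Ioo h, lintegral_const_mul' _ _
    (ENNReal.mul_ne_top ENNReal.ofReal_ne_top lintegral_Ioi_twoK0_sqrt_ne_top),
    lintegral_one_sub_cos_div_sin_sq, mul_one]

lemma besselI0_nonneg (x : ℝ) : 0 ≤ besselI0 x :=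
  mul_nonneg (by positivity) (intervalIntegral.integral_nonneg Real.pi_pos.le
    fun θ _ => (Real.cosh_pos _).le)

lemma besselK0_nonneg (x : ℝ) : 0 ≤ besselK0 x :=
  integral_nonneg fun _ => (Real.exp_pos _).le

lemma inv_two_mul_sub_besselI0_mul_besselK0 {x : ℝ} (hx : 0 < x) :
    Real.pi / (2 * x) - Real.pi * besselI0 x * besselK0 x
      = (posDefect x).toReal - (negDefect x).toReal := by
  have hI := besselI0_nonneg x
  have hK := besselK0_nonneg x
  have h := congrArg ENNReal.toReal (besselI0_mul_besselK0_add_posDefect hx)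
  rw [ENNReal.toReal_add ENNReal.ofReal_ne_top (posDefect_ne_top hx),
    ENNReal.toReal_add (negDefect_ne_top hx) ENNReal.ofReal_ne_top,
    ENNReal.toReal_ofReal (by positivity), ENNReal.toReal_ofReal (by positivity)] at h
  linarith

/-- For `z > 0`, `∫₀^∞ [1/(2√ω) − z I₀(√ω z) K₀(√ω z)] dω` converges and equals `0`. -/
theorem critical_selfconsistency (z : ℝ) (hz : 0 < z) :
    IntegrableOn
      (fun ω : ℝ => 1 / (2 * Real.sqrt ω)
        - z * besselI0 (Real.sqrt ω * z) * besselK0 (Real.sqrt ω * z)) (Set.Ioi 0) ∧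
    ∫ ω in Set.Ioi (0:ℝ),
        (1 / (2 * Real.sqrt ω)
          - z * besselI0 (Real.sqrt ω * z) * besselK0 (Real.sqrt ω * z)) = 0 := by
  have hD : ENNReal.ofReal (1 / (2 * z) ^ 2) * ∫⁻ w in Set.Ioi (0 : ℝ), twoK0 √w ≠ ⊤ :=
    ENNReal.mul_ne_top ENNReal.ofReal_ne_top lintegral_Ioi_twoK0_sqrt_ne_top
  have hmP : AEMeasurable (fun w => posDefect (√w * z)) (volume.restrict (Set.Ioi 0)) :=
    (measurable_posDefect.comp (by fun_prop)).aemeasurable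
  have hmN : AEMeasurable (fun w => negDefect (√w * z)) (volume.restrict (Set.Ioi 0)) :=
    (measurable_negDefect.comp (by fun_prop)).aemeasurable
  have hP : IntegrableOn (fun w => (posDefect (√w * z)).toReal) (Set.Ioi 0) :=
    integrable_toReal_of_lintegral_ne_top hmP (by rwa [lintegral_posDefect hz])
  have hN : IntegrableOn (fun w => (negDefect (√w * z)).toReal) (Set.Ioi 0) :=
    integrable_toReal_of_lintegral_ne_top hmN (by rwa [lintegral_negDefect hz])
  have hPN : ∫ w in Set.Ioi (0 : ℝ), (posDefect (√w * z)).toReal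
      = ∫ w in Set.Ioi (0 : ℝ), (negDefect (√w * z)).toReal := by
    rw [integral_toReal hmP (ae_lt_top' hmP (by rwa [lintegral_posDefect hz])),
      integral_toReal hmN (ae_lt_top' hmN (by rwa [lintegral_negDefect hz])),
      lintegral_posDefect hz, lintegral_negDefect hz]
  have heq : Set.EqOn (fun w : ℝ => z / Real.pi *
      ((posDefect (√w * z)).toReal - (negDefect (√w * z)).toReal))
      (fun ω : ℝ => 1 / (2 * Real.sqrt ω)
        - z * besselI0 (Real.sqrt ω * z) * besselK0 (Real.sqrt ω * z)) (Set.Ioi 0) := by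
    intro w hw
    have hs : 0 < √w := Real.sqrt_pos.2 hw
    have hpi := Real.pi_pos
    simp only
    rw [← inv_two_mul_sub_besselI0_mul_besselK0 (mul_pos hs hz)]
    field_simp
  refine ⟨IntegrableOn.congr_fun ((hP.sub hN).const_mul (z / Real.pi)) heq measurableSet_Ioi, ?_⟩
  rw [← setIntegral_congr_fun measurableSet_Ioi heq, integral_const_mul, integral_sub hP hN, hPN,
    sub_self, mul_zero]
end
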